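/- arXiv:1401.5665 — 4 statements merged into one kernel-verified Lean document; each statement's English description precedes it below -/
import Mathlib

section
/- Let C be a total clone on 𝟚 = {0,1}. Then the interval I_str(C) is either finite or has the cardinality of the continuum (2^{ℵ₀}). Moreover, I_str(C) is finite if and only if M ∩ T_0 ∩ T_1 ⊆ C or S ∩ T_0 ∩ T_1 ⊆ C, where T_a := Pol {{(a)}} for a ∈ {0,1}, M := Pol {{(0,0),(0,1),(1,1)}} is the clone of monotone Boolean functions, and S := Pol {{(0,1),(1,0)}} is the clone of self-dual Boolean functions. -/
namespace StrongPartial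

/-- Partial functions of arity `n+1` on `A` (arities are `≥ 1`).
`f.2 x = some a` means `x ∈ dom f` with value `a`; `f.2 x = none` means `x ∉ dom f`. -/
def PF (A : Type) : Type := Σ n : ℕ, (Fin (n+1) → A) → Option A

variable {A : Type}

/-- `f` is a total function. -/
def IsTotalPF (f : PF A) : Prop := ∀ x, (f.2 x).isSome

/-- The set of all total functions on `A`. -/
def OSet (A : Type) : Set (PF A) := {f | IsTotalPF f}

/-- The `(n+1)`-ary projection onto the `i`-th coordinate. -/
def proj (n : ℕ) (i : Fin (n+1)) : PF A := ⟨n, fun x => some (x i)⟩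

/-- Composition of an arity-`k` partial function with `k` partial functions of arity `m`. -/
def compFun {k m : ℕ} (f : (Fin k → A) → Option A) (g : Fin k → ((Fin m → A) → Option A)) :
    (Fin m → A) → Option A :=
  fun x => if h : ∀ i, (g i x).isSome then f (fun i => (g i x).get (h i)) else none

/-- A partial clone: contains all projections and is closed under composition. -/
def IsPartialClone (X : Set (PF A)) : Prop :=
  (∀ (n : ℕ) (i : Fin (n+1)), proj n i ∈ X) ∧
  (∀ f ∈ X, ∀ (m : ℕ) (g : Fin (f.1+1) → ((Fin (m+1) → A) → Option A)),
     (∀ i, (⟨m, g i⟩ : PF A) ∈ X) → (⟨m, compFun f.2 g⟩ : PF A) ∈ X)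

/-- A total clone: a partial clone consisting of total functions. -/
def IsClone (C : Set (PF A)) : Prop := IsPartialClone C ∧ C ⊆ OSet A

/-- `f ≤ g`: `f` is a restriction (subfunction) of `g`. -/
def PFle (f g : PF A) : Prop :=
  ∃ h : f.1 = g.1, ∀ (x : Fin (f.1+1) → A) (a : A),
    f.2 x = some a → g.2 (fun i => x (Fin.cast (by rw [h]) i)) = some a

/-- `Str X`: all restrictions of members of `X`. -/
def StrSet (X : Set (PF A)) : Set (PF A) := {f | ∃ g ∈ X, PFle f g}

/-- `X` is strong (restriction closed). -/
def IsStrong (X : Set (PF A)) : Prop := StrSet X = X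

/-- `f` preserves the `h`-ary relation `ρ`. -/
def Preserves (f : PF A) {h : ℕ} (ρ : Set (Fin h → A)) : Prop :=
  ∀ (M : Fin h → Fin (f.1+1) → A) (v : Fin h → A),
    (∀ j, (fun i => M i j) ∈ ρ) → (∀ i, f.2 (M i) = some (v i)) → v ∈ ρ

def pPolSet {h : ℕ} (ρ : Set (Fin h → A)) : Set (PF A) := {f | Preserves f ρ}

def PolSet {h : ℕ} (ρ : Set (Fin h → A)) : Set (PF A) := pPolSet ρ ∩ OSet A

/-- `f` preserves the relation pair `(ρ, ρ')`. -/
def PreservesPair (f : PF A) {h : ℕ} (ρ ρ' : Set (Fin h → A)) : Prop :=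
  ∀ (M : Fin h → Fin (f.1+1) → A) (v : Fin h → A),
    (∀ j, (fun i => M i j) ∈ ρ) → (∀ i, f.2 (M i) = some (v i)) → v ∈ ρ'

def cPolSet {h : ℕ} (ρ ρ' : Set (Fin h → A)) : Set (PF A) := {f | PreservesPair f ρ ρ'}

/-- The interval `I_str(C)` of strong partial clones with total part `C`. -/
def Istr (C : Set (PF A)) : Set (Set (PF A)) :=
  {X | IsPartialClone X ∧ IsStrong X ∧ X ∩ OSet A = C}

/-! Maltsev operations -/

def zeta (f : PF A) : PF A := ⟨f.1, fun x => f.2 (fun i => x (i + 1))⟩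

def tau (f : PF A) : PF A := ⟨f.1, fun x => f.2 (fun i => x (Equiv.swap 0 1 i))⟩

def nabla (f : PF A) : PF A := ⟨f.1 + 1, fun x => f.2 (fun i => x i.succ)⟩

def delta (f : PF A) : PF A :=
  match f with
  | ⟨0, g⟩ => ⟨0, g⟩
  | ⟨n+1, g⟩ => ⟨n, fun x => g (fun i => x ⟨i.val - 1, by have := i.isLt; omega⟩)⟩

/-- `f ⋆ g`. -/
def starPF (f g : PF A) : PF A :=
  ⟨f.1 + g.1, fun x =>
    (g.2 (fun j => x ⟨j.val, by have := j.isLt; omega⟩)).bind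
      (fun a => f.2 (fun i =>
        if i.val = 0 then a else x ⟨g.1 + i.val, by have := i.isLt; omega⟩))⟩

/-- A partial class: closed under `ζ`, `τ`, `Δ`, `∇` and `⋆`. -/
def IsPartialClass (X : Set (PF A)) : Prop :=
  (∀ f ∈ X, zeta f ∈ X) ∧ (∀ f ∈ X, tau f ∈ X) ∧ (∀ f ∈ X, delta f ∈ X) ∧
  (∀ f ∈ X, nabla f ∈ X) ∧ (∀ f ∈ X, ∀ g ∈ X, starPF f g ∈ X)

def starSet (X Y : Set (PF A)) : Set (PF A) := {h | ∃ f ∈ X, ∃ g ∈ Y, h = starPF f g}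

/-- The constant function of arity `n+1` with value `a`. -/
def constPF (a : A) (n : ℕ) : PF A := ⟨n, fun _ => some a⟩

/-- The total clone generated by a set `G` of total functions. -/
def cloneGen (G : Set (PF A)) : Set (PF A) := ⋂₀ {C | IsClone C ∧ G ⊆ C}


/-! Boolean-specific definitions (`0 = false`, `1 = true`). -/

/-- `T_0 = Pol {(0)}`. -/
def relT0 : Set (Fin 1 → Bool) := {fun _ => false}

/-- `T_1 = Pol {(1)}`. -/
def relT1 : Set (Fin 1 → Bool) := {fun _ => true}

/-- `{(0,0),(0,1),(1,1)}`, defining the monotone functions. -/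
def relM : Set (Fin 2 → Bool) := {![false, false], ![false, true], ![true, true]}

/-- `{(0,1),(1,0)}`, defining the self-dual functions. -/
def relS : Set (Fin 2 → Bool) := {![false, true], ![true, false]}

/-- `{(x,x,y,y),(x,y,x,y),(x,y,y,x) : x,y ∈ 𝟚}`, defining the linear functions. -/
def relL : Set (Fin 4 → Bool) :=
  {v | ∃ x y : Bool, v = ![x, x, y, y] ∨ v = ![x, y, x, y] ∨ v = ![x, y, y, x]}

def T0 : Set (PF Bool) := PolSet relT0
def T1 : Set (PF Bool) := PolSet relT1
def Mclone : Set (PF Bool) := PolSet relM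
def Sclone : Set (PF Bool) := PolSet relS
def Lclone : Set (PF Bool) := PolSet relL

/-- `ρ_{0,2} = {(0,0),(0,1),(1,0)}`. -/
def rel02 : Set (Fin 2 → Bool) := {![false, false], ![false, true], ![true, false]}

/-- `T_{0,2} = Pol ρ_{0,2}`. -/
def T02 : Set (PF Bool) := PolSet rel02

/-- Cyclic successor on `Fin n`. -/
def cyc {n : ℕ} (i : Fin n) : Fin n := ⟨(i.val + 1) % n, Nat.mod_lt _ (by have := i.isLt; omega)⟩

/-- `R^{0,2}_{C,n}`: the cyclic-graph relation. -/
def RC (n : ℕ) : Set (Fin n → Bool) := {x | ∀ i : Fin n, ![x i, x (cyc i)] ∈ rel02}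

/-- `R^{0,2}_{K,n}`: the complete-graph relation. -/
def RK (n : ℕ) : Set (Fin n → Bool) := {x | ∀ i j : Fin n, i ≠ j → ![x i, x j] ∈ rel02}

/-- `R^{0,2}_n := R^{0,2}_{C,n} × R^{0,2}_{K,n} ⊆ 𝟚^{2n}`. -/
def R02 (n : ℕ) : Set (Fin (n + n) → Bool) :=
  {x | (fun i => x (Fin.castAdd n i)) ∈ RC n ∧ (fun i => x (Fin.natAdd n i)) ∈ RK n}

/-- The binary conjunction as a partial (total) function. -/
def andPF : PF Bool := ⟨1, fun x => some (x 0 && x 1)⟩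

/-- The constant Boolean functions `c_0, c_1` of all arities. -/
def constantsBool : Set (PF Bool) :=
  {f | ∃ n : ℕ, f = constPF false n ∨ f = constPF true n}

/-- `C_{01}`: the clone generated by the constants `c_0, c_1`. -/
def C01 : Set (PF Bool) := cloneGen constantsBool

/-- `Λ`: the clone generated by `∧, c_0, c_1`. -/
def LambdaClone : Set (PF Bool) := cloneGen (insert andPF constantsBool)

/-- The monster relation `R^Λ_m ⊆ 𝟚^{m+1}` (coordinates 0-indexed: index 0 is the paper's 1). -/
def RLam (m : ℕ) : Set (Fin (m+1) → Bool) :=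
  {x | (x 0 = true ∨ ∃ j : Fin (m+1), j ≠ 0 ∧ x j = false) ∧
       ∀ i j1 j2 : Fin (m+1), i ≠ 0 → j1 ≠ 0 → j2 ≠ 0 → i ≠ j1 → i ≠ j2 → j1 ≠ j2 →
         (x i = true ∨ x 0 = false ∨ x j1 = false ∨ x j2 = false)}

/-- `n(k,p) := (2k−1)p + 1`. -/
def nkp (k p : ℕ) : ℕ := (2 * k - 1) * p + 1

/-- The `n(k,p)`-ary partial function `τ_p^k`. -/
def tauPF (k p : ℕ) : PF Bool :=
  ⟨nkp k p - 1, fun x =>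
    if ∀ i, x i = true then some true
    else if (Finset.univ.filter (fun i => x i = true)).card ≤ p then some false
    else none⟩

/-- `p_1 := 1`, `p_j := n(j, p_{j−1})` for `j ≥ 2`. -/
def pseq : ℕ → ℕ
  | 0 => 1
  | 1 => 1
  | (j+2) => nkp (j+2) (pseq (j+1))

/-- `ξ_j := τ^{j+1}_{p_j}`. -/
def xi (j : ℕ) : PF Bool := tauPF (j + 1) (pseq j)

/-- `ρ_C = {(0,0,0,0),(0,0,1,1),(0,1,0,1),(1,1,1,1)}`. -/
def rhoC : Set (Fin 4 → Bool) :=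
  {![false, false, false, false], ![false, false, true, true],
   ![false, true, false, true], ![true, true, true, true]}

/-- `ρ_1 = ρ_C ∪ {(1,0,1,0),(1,1,0,0)}`. -/
def rho1 : Set (Fin 4 → Bool) :=
  rhoC ∪ {![true, false, true, false], ![true, true, false, false]}

/-- `f_a`: extension of `f` fixing the new first coordinate to `a`. -/
def extConst {A : Type} [DecidableEq A] (a : A) (f : PF A) : PF A :=
  ⟨f.1 + 1, fun x => if x 0 = a then f.2 (fun i => x i.succ) else none⟩



/-- total function as a partial function -/
def tot {n : ℕ} (F : (Fin (n+1) → Bool) → Bool) : PF Bool := ⟨n, fun x => some (F x)⟩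

theorem tot_inj {n : ℕ} {F G : (Fin (n+1) → Bool) → Bool} (h : tot F = tot G) : F = G := by
  have h2 : HEq (fun x => some (F x)) (fun x => some (G x)) := (Sigma.mk.inj_iff.1 h).2
  have h3 := eq_of_heq h2
  funext x
  exact Option.some.inj (congrFun h3 x)

theorem exists_tot {f : PF Bool} (h : f ∈ OSet Bool) :
    ∃ (n : ℕ) (F : (Fin (n+1) → Bool) → Bool), f = tot F := by
  obtain ⟨n, f⟩ := f
  refine ⟨n, fun x => (f x).get (h x), ?_⟩
  unfold tot
  congr
  funext x
  simp

theorem tot_mem_OSet {n : ℕ} (F : (Fin (n+1) → Bool) → Bool) : tot F ∈ OSet Bool := by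
  intro x; simp [tot]

/-- membership of a total function with arbitrary index type -/
def TM (C : Set (PF Bool)) {ι : Type} (F : (ι → Bool) → Bool) : Prop :=
  ∀ (m : ℕ) (p : ι → Fin (m+1)), tot (fun x => F (fun i => x (p i))) ∈ C

theorem comp_tot {X : Set (PF Bool)} (hX : IsPartialClone X) {k m : ℕ}
    {F : (Fin (k+1) → Bool) → Bool} {G : Fin (k+1) → (Fin (m+1) → Bool) → Bool}
    (hF : tot F ∈ X) (hG : ∀ i, tot (G i) ∈ X) : tot (fun x => F (fun i => G i x)) ∈ X := by
  have := hX.2 (tot F) hF m (fun i x => some (G i x)) hG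
  have h2 : tot (fun x => F (fun i => G i x)) = ⟨m, compFun (tot F).2 (fun i x => some (G i x))⟩ := by
    unfold tot compFun
    congr
    funext x
    simp
  rw [h2]; exact this

theorem tot_proj {X : Set (PF Bool)} (hX : IsPartialClone X) {n : ℕ} (i : Fin (n+1)) :
    tot (fun x => x i) ∈ X := hX.1 n i

theorem TM_of_mem {X : Set (PF Bool)} (hX : IsPartialClone X) {n : ℕ}
    {F : (Fin (n+1) → Bool) → Bool} (h : tot F ∈ X) : TM X F := by
  intro m p
  exact comp_tot hX h (G := fun i x => x (p i)) (fun i => tot_proj hX (p i))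

theorem TM_mem {X : Set (PF Bool)} {n : ℕ}
    {F : (Fin (n+1) → Bool) → Bool} (h : TM X F) : tot F ∈ X := h n id

theorem TM_proj {X : Set (PF Bool)} (hX : IsPartialClone X) {ι : Type} (i : ι) :
    TM X (fun x : ι → Bool => x i) := fun _ p => tot_proj hX (p i)

theorem exists_equiv_fin (ι : Type) [Finite ι] [Nonempty ι] : ∃ k : ℕ, Nonempty (ι ≃ Fin (k+1)) := by
  have e := Finite.equivFin ι
  have : Nat.card ι ≠ 0 := Nat.card_pos.ne'
  obtain ⟨k, hk⟩ := Nat.exists_eq_succ_of_ne_zero this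
  exact ⟨k, ⟨e.trans (finCongr hk)⟩⟩

theorem TM_comp {X : Set (PF Bool)} (hX : IsPartialClone X) {ι κ : Type} [Finite ι] [Nonempty ι]
    {F : (ι → Bool) → Bool} {G : ι → (κ → Bool) → Bool}
    (hF : TM X F) (hG : ∀ i, TM X (G i)) : TM X (fun x => F (fun i => G i x)) := by
  intro m p
  obtain ⟨k, ⟨e⟩⟩ := exists_equiv_fin ι
  have h1 := hF k e
  have := comp_tot hX h1 (G := fun j x => G (e.symm j) (fun i => x (p i))) (fun j => hG _ m p)
  simpa using this

/-- preservation with arbitrary row index -/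
def GPres (f : PF Bool) {W : Type} (B : Set (W → Bool)) : Prop :=
  ∀ (M : W → Fin (f.1+1) → Bool) (v : W → Bool),
    (∀ j, (fun i => M i j) ∈ B) → (∀ i, f.2 (M i) = some (v i)) → v ∈ B

theorem GPres_proj {W : Type} (B : Set (W → Bool)) (n : ℕ) (i : Fin (n+1)) :
    GPres (proj n i) B := by
  intro M v h1 h2
  have : v = fun w => M w i := by
    funext w
    have := h2 w
    simpa [proj] using this.symm
  rw [this]; exact h1 i

theorem compFun_some {k m : ℕ} {f : (Fin k → Bool) → Option Bool}
    {g : Fin k → ((Fin m → Bool) → Option Bool)} {x : Fin m → Bool} {b : Bool}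
    (h : compFun f g x = some b) : ∃ y : Fin k → Bool, (∀ i, g i x = some (y i)) ∧ f y = some b := by
  unfold compFun at h
  split_ifs at h with h1
  exact ⟨_, fun i => by simp, h⟩

theorem GPres_comp {W : Type} (B : Set (W → Bool)) (f : PF Bool) (hf : GPres f B) (m : ℕ)
    (g : Fin (f.1+1) → ((Fin (m+1) → Bool) → Option Bool))
    (hg : ∀ i, GPres (⟨m, g i⟩ : PF Bool) B) : GPres (⟨m, compFun f.2 g⟩ : PF Bool) B := by
  intro M v h1 h2
  choose y hy hy2 using fun w => compFun_some (h2 w)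
  exact hf y v (fun j => hg j M _ h1 (fun w => hy w j)) hy2

theorem PFle_elim {f g : PF Bool} (h : PFle f g) :
    ∃ g' : (Fin (f.1+1) → Bool) → Option Bool, g = ⟨f.1, g'⟩ ∧ ∀ x a, f.2 x = some a → g' x = some a := by
  obtain ⟨n, f⟩ := f
  obtain ⟨m, g⟩ := g
  obtain ⟨h, hx⟩ := h
  dsimp at h
  subst h
  exact ⟨g, rfl, fun x a => hx x a⟩

theorem PFle_intro {n : ℕ} {f g : (Fin (n+1) → Bool) → Option Bool}
    (h : ∀ x a, f x = some a → g x = some a) : PFle (⟨n, f⟩ : PF Bool) ⟨n, g⟩ :=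
  ⟨rfl, fun x a => h x a⟩

theorem strong_of {X : Set (PF Bool)}
    (h : ∀ n (f g : (Fin (n+1) → Bool) → Option Bool), (⟨n, g⟩ : PF Bool) ∈ X →
      (∀ x a, f x = some a → g x = some a) → (⟨n, f⟩ : PF Bool) ∈ X) : IsStrong X := by
  apply Set.eq_of_subset_of_subset
  · rintro ⟨n, f⟩ ⟨g, hg, hfg⟩
    obtain ⟨g', rfl, h2⟩ := PFle_elim hfg
    exact h _ _ _ hg h2
  · rintro ⟨n, f⟩ hf
    exact ⟨_, hf, PFle_intro (fun _ _ h => h)⟩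

theorem strong_elim {X : Set (PF Bool)} (hX : IsStrong X) {n} {f g : (Fin (n+1) → Bool) → Option Bool}
    (hg : (⟨n, g⟩ : PF Bool) ∈ X)
    (h : ∀ x a, f x = some a → g x = some a) : (⟨n, f⟩ : PF Bool) ∈ X := by
  rw [← hX]
  exact ⟨_, hg, PFle_intro h⟩

/-- the largest element of the interval -/
def Ymax (C : Set (PF Bool)) : Set (PF Bool) :=
  {f | ∀ (m : ℕ) (g : Fin (f.1+1) → (Fin (m+1) → Bool) → Bool) (u : (Fin (m+1) → Bool) → Bool),
    (∀ i, tot (g i) ∈ C) → (∀ x, f.2 (fun i => g i x) = some (u x)) → tot u ∈ C}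

def XI (C : Set (PF Bool)) (V : ℕ → Type) (A : ∀ n, Set (V n → Bool)) (I : Set ℕ) : Set (PF Bool) :=
  {f | f ∈ Ymax C ∧ ∀ n ∈ I, GPres f (A n)}

theorem XI_mem {C : Set (PF Bool)} (hC : IsClone C) (V : ℕ → Type) (A : ∀ n, Set (V n → Bool))
    (hA : ∀ n, ∀ f ∈ C, GPres f (A n)) (I : Set ℕ) : XI C V A I ∈ Istr C := by
  refine ⟨⟨?_, ?_⟩, ?_, ?_⟩
  · intro n i
    refine ⟨?_, fun n _ => GPres_proj _ _ _⟩
    intro m g u hg hu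
    have : u = g i := by
      funext x
      simpa [proj] using (hu x).symm
    rw [this]; exact hg i
  · rintro f ⟨hf1, hf2⟩ m g hg
    refine ⟨?_, fun n hn => GPres_comp _ _ (hf2 n hn) _ _ (fun i => (hg i).2 n hn)⟩
    intro k h u hh hu
    choose y hy hy2 using fun x => compFun_some (hu x)
    exact hf1 k (fun i x => y x i) u (fun i => (hg i).1 k h _ hh (fun x => hy x i)) hy2
  · apply strong_of
    rintro n f g ⟨h1, h2⟩ hfg
    refine ⟨fun m h u hh hu => h1 m h u hh (fun x => hfg _ _ (hu x)), fun k hk M v hM hv =>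
      h2 k hk M v hM (fun i => hfg _ _ (hv i))⟩
  · apply Set.eq_of_subset_of_subset
    · rintro f ⟨⟨h1, _⟩, h2⟩
      obtain ⟨n, F, rfl⟩ := exists_tot h2
      exact h1 n (fun i x => x i) F (fun i => tot_proj hC.1 i) (fun x => rfl)
    · intro f hf
      have hO := hC.2 hf
      refine ⟨⟨?_, fun n _ => hA n f hf⟩, hO⟩
      obtain ⟨n, F, rfl⟩ := exists_tot hO
      intro m g u hg hu
      have : u = fun x => F (fun i => g i x) := by
        funext x
        exact (Option.some.inj (hu x)).symm
      rw [this]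
      exact comp_tot hC.1 hf hg

/-- the partial function associated with a relation and a non-member -/
theorem exists_pf {V : Type} [Finite V] (A : Set (V → Bool)) (hne : A.Nonempty)
    (hsep : ∀ v w : V, (∀ x ∈ A, x v = x w) → v = w) (t : V → Bool) :
    ∃ f : PF Bool, (t ∉ A → ¬ GPres f A) ∧
      (∀ (W : Type) (B : Set (W → Bool)), (∀ e : W → V, (∀ x ∈ A, (fun w => x (e w)) ∈ B) →
        (fun w => t (e w)) ∈ B) → GPres f B) ∧
      (∀ C : Set (PF Bool), (∀ (m : ℕ) (E : (Fin (m+1) → Bool) → V),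
        (∀ x ∈ A, tot (fun y => x (E y)) ∈ C) → tot (fun y => t (E y)) ∈ C) → f ∈ Ymax C) := by
  classical
  have : Nonempty A := hne.to_subtype
  obtain ⟨N, ⟨s⟩⟩ := exists_equiv_fin A
  let f : (Fin (N+1) → Bool) → Option Bool := fun y =>
    if h : ∃ v, ∀ j, y j = (s.symm j).1 v then some (t h.choose) else none
  have hf : ∀ v, f (fun j => (s.symm j).1 v) = some (t v) := by
    intro v
    have h : ∃ v', ∀ j, (fun j => (s.symm j).1 v) j = (s.symm j).1 v' := ⟨v, fun j => rfl⟩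
    have h2 : h.choose = v := by
      apply hsep
      intro x hx
      have := h.choose_spec (s ⟨x, hx⟩)
      simpa using this.symm
    simp only [f, dif_pos h, h2]
  have hf2 : ∀ y b, f y = some b → ∃ v, (∀ j, y j = (s.symm j).1 v) ∧ t v = b := by
    intro y b h
    simp only [f] at h
    split_ifs at h with h1
    exact ⟨_, h1.choose_spec, Option.some.inj h⟩
  refine ⟨⟨N, f⟩, ?_, ?_, ?_⟩
  · intro ht hp
    exact ht (hp (fun v j => (s.symm j).1 v) t (fun j => (s.symm j).2) hf)
  · intro W B h M v hM hv
    choose e he het using fun w => hf2 _ _ (hv w)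
    have := h e (fun x hx => by
      have := hM (s ⟨x, hx⟩)
      convert this using 2 with w
      rw [he]; simp)
    convert this using 2 with w
    exact (het w).symm
  · intro C h m g u hg hu
    choose E hE hEt using fun x => hf2 _ _ (hu x)
    have := h m E (fun x hx => by
      have := hg (s ⟨x, hx⟩)
      convert this using 2
      funext y
      have := hE y (s ⟨x, hx⟩)
      simpa using this.symm)
    convert this using 2
    funext y
    exact (hEt y).symm

theorem Istr_le (C : Set (PF Bool)) : Cardinal.mk ↥(Istr C) ≤ Cardinal.continuum := by
  have hc : Countable (PF Bool) := by unfold PF; infer_instance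
  calc Cardinal.mk ↥(Istr C) ≤ Cardinal.mk (Set (PF Bool)) := Cardinal.mk_set_le _
    _ = 2 ^ Cardinal.mk (PF Bool) := Cardinal.mk_set
    _ ≤ 2 ^ Cardinal.aleph0 := Cardinal.power_le_power_left two_ne_zero (Cardinal.mk_le_aleph0)
    _ = Cardinal.continuum := Cardinal.two_power_aleph0

theorem continuum_of {C : Set (PF Bool)} (hC : IsClone C) (V : ℕ → Type) [∀ n, Finite (V n)]
    (A : ∀ n, Set (V n → Bool)) (t : ∀ n, V n → Bool)
    (hsep : ∀ n, ∀ v w : V n, (∀ x ∈ A n, x v = x w) → v = w)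
    (hne : ∀ n, (A n).Nonempty)
    (h1 : ∀ n, ∀ f ∈ C, GPres f (A n))
    (h2 : ∀ m n, m ≠ n → ∀ e : V m → V n, (∀ x ∈ A n, (fun w => x (e w)) ∈ A m) →
      (fun w => t n (e w)) ∈ A m)
    (h3 : ∀ n, t n ∉ A n)
    (h4 : ∀ n (m : ℕ) (E : (Fin (m+1) → Bool) → V n),
        (∀ x ∈ A n, tot (fun y => x (E y)) ∈ C) → ∃ x ∈ A n, ∀ y, t n (E y) = x (E y)) :
    Cardinal.continuum ≤ Cardinal.mk ↥(Istr C) := by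
  choose f hf1 hf2 hf3 using fun n => exists_pf (A n) (hne n) (hsep n) (t n)
  have key : ∀ I n, f n ∈ XI C V A I ↔ n ∉ I := by
    intro I n
    constructor
    · intro h hn
      exact hf1 n (h3 n) (h.2 n hn)
    · intro hn
      refine ⟨hf3 n C ?_, ?_⟩
      · intro m E hE
        obtain ⟨x, hx, hxt⟩ := h4 n m E hE
        have := hE x hx
        simpa only [hxt] using this
      · intro m hm
        apply hf2
        exact h2 m n (by rintro rfl; exact hn hm)
  have hinj : Function.Injective (fun I : Set ℕ => (⟨XI C V A I, XI_mem hC V A h1 I⟩ : ↥(Istr C))) := by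
    intro I J h
    have h' : XI C V A I = XI C V A J := congrArg Subtype.val h
    ext n
    have a := key I n
    have b := key J n
    rw [h'] at a
    tauto
  calc Cardinal.continuum = Cardinal.mk (Set ℕ) := by
        rw [Cardinal.mk_set, Cardinal.mk_nat, Cardinal.two_power_aleph0]
    _ ≤ _ := Cardinal.mk_le_of_injective hinj

/-- a property of total members -/
theorem GPres_tot {C : Set (PF Bool)} (hC : IsClone C) {W : Type} {B : Set (W → Bool)}
    (h : ∀ n (F : (Fin (n+1) → Bool) → Bool), tot F ∈ C → ∀ M : W → Fin (n+1) → Bool,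
      (∀ j, (fun i => M i j) ∈ B) → (fun w => F (M w)) ∈ B) : ∀ f ∈ C, GPres f B := by
  intro f hf
  obtain ⟨n, F, rfl⟩ := exists_tot (hC.2 hf)
  intro M v hM hv
  have := h n F hf M hM
  convert this using 2 with w
  exact (Option.some.inj (hv w)).symm

def IsT02 {κ : Type} (F : (κ → Bool) → Bool) : Prop :=
  ∀ a b, F a = true → F b = true → ∃ i, a i = true ∧ b i = true
def IsT12 {κ : Type} (F : (κ → Bool) → Bool) : Prop :=
  ∀ a b, F a = false → F b = false → ∃ i, a i = false ∧ b i = false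
def IsL {κ : Type} (F : (κ → Bool) → Bool) : Prop :=
  ∀ a b c, F (fun i => xor (xor (a i) (b i)) (c i)) = xor (xor (F a) (F b)) (F c)
def IsMeet {κ : Type} (F : (κ → Bool) → Bool) : Prop :=
  ∀ a b, F (fun i => a i && b i) = (F a && F b)
def IsJoin {κ : Type} (F : (κ → Bool) → Bool) : Prop :=
  ∀ a b, F (fun i => a i || b i) = (F a || F b)

/-! ### the family for `T02` -/

abbrev GV (n : ℕ) : Type := ZMod (2*n+5) ⊕ Fin (2*n+5)

def gadj (n : ℕ) : GV n → GV n → Prop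
  | Sum.inl a, Sum.inl b => b = a + 1 ∨ a = b + 1
  | Sum.inr a, Sum.inr b => a ≠ b
  | _, _ => False

theorem gadj_symm {n : ℕ} {u v : GV n} (h : gadj n u v) : gadj n v u := by
  rcases u with u | u <;> rcases v with v | v <;> simp only [gadj] at h ⊢
  · exact h.symm
  · exact h.symm

theorem gadj_irrefl {n : ℕ} (u : GV n) : ¬ gadj n u u := by
  rcases u with u | u <;> simp [gadj]
  haveI : Fact (1 < 2*n+5) := ⟨by omega⟩
  exact one_ne_zero

def GA (n : ℕ) : Set (GV n → Bool) := {x | ∀ u v, gadj n u v → ¬ (x u = true ∧ x v = true)}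

def Gt (n : ℕ) : GV n → Bool
  | Sum.inl _ => true
  | Sum.inr _ => false

theorem GA_pair {n : ℕ} {u v : GV n} (h : ¬ gadj n u v) :
    ∃ x ∈ GA n, x u = true ∧ x v = true := by
  classical
  refine ⟨fun w => decide (w = u ∨ w = v), ?_, by simp, by simp⟩
  rintro a b hab ⟨ha, hb⟩
  simp only [decide_eq_true_eq] at ha hb
  rcases ha with rfl | rfl <;> rcases hb with rfl | rfl
  · exact gadj_irrefl _ hab
  · exact h hab
  · exact h (gadj_symm hab)
  · exact gadj_irrefl _ hab

theorem cycle_hom {k l : ℕ} [NeZero k] (hk : k % 2 = 1) (hl : 0 < l) (f : ZMod k → ZMod l)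
    (hf : ∀ i, f (i+1) = f i + 1 ∨ f i = f (i+1) + 1) : l % 2 = 1 → l ≤ k := by
  intro hl2
  have : ∀ i, ∃ ε : ℤ, (ε = 1 ∨ ε = -1) ∧ f (i+1) = f i + (ε : ZMod l) := by
    intro i
    rcases hf i with h | h
    · exact ⟨1, Or.inl rfl, by simp [h]⟩
    · exact ⟨-1, Or.inr rfl, by rw [h]; simp⟩
  choose ε h1 h2 using this
  have hs : ∑ i, f (i+1) = ∑ i, f i := Equiv.sum_comp (Equiv.addRight (1 : ZMod k)) f
  simp only [h2, Finset.sum_add_distrib] at hs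
  have hz : ((∑ i, ε i : ℤ) : ZMod l) = 0 := by
    push_cast
    simpa using hs
  rw [ZMod.intCast_zmod_eq_zero_iff_dvd] at hz
  have hodd : (∑ i, ε i) % 2 = 1 := by
    have : ∀ i, ε i % 2 = 1 := by
      intro i; rcases h1 i with h | h <;> rw [h] <;> rfl
    rw [Finset.sum_int_mod]
    simp only [this]
    simp [ZMod.card]
    omega
  have hle : |∑ i, ε i| ≤ k := by
    calc |∑ i, ε i| ≤ ∑ i, |ε i| := Finset.abs_sum_le_sum_abs _ _
      _ = ∑ i : ZMod k, 1 := by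
        apply Finset.sum_congr rfl
        intro i _
        rcases h1 i with h | h <;> simp [h]
      _ = k := by simp [ZMod.card]
  have hne : (∑ i, ε i) ≠ 0 := by intro h; rw [h] at hodd; simp at hodd
  have := Int.le_of_dvd (abs_pos.2 hne) ((dvd_abs _ _).2 hz)
  omega

theorem no_triangle {l : ℕ} (hl : 5 ≤ l) (a b c : ZMod l) (h1 : b = a + 1 ∨ a = b + 1)
    (h2 : c = b + 1 ∨ b = c + 1) (h3 : a = c + 1 ∨ c = a + 1) (hl2 : l % 2 = 1) : False := by
  have := cycle_hom (k := 3) (l := l) rfl (by omega) ![a, b, c] (by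
    intro i
    fin_cases i
    · exact h1
    · exact h2
    · exact h3) hl2
  omega

theorem G_hom {m n : ℕ} (e : GV m → GV n) (he : ∀ x ∈ GA n, (fun w => x (e w)) ∈ GA m) :
    ∀ u v, gadj m u v → gadj n (e u) (e v) := by
  intro u v h
  by_contra hn
  obtain ⟨x, hx, h1, h2⟩ := GA_pair hn
  exact he x hx u v h ⟨h1, h2⟩

theorem G_indep {m n : ℕ} (hmn : m ≠ n) (e : GV m → GV n)
    (he : ∀ x ∈ GA n, (fun w => x (e w)) ∈ GA m) : (fun w => Gt n (e w)) ∈ GA m := by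
  have hom := G_hom e he
  -- the clique part
  have hK : ∀ a, ∃ b, e (Sum.inr a) = Sum.inr b := by
    by_contra hcon
    push Not at hcon
    obtain ⟨a, ha⟩ := hcon
    have hall : ∀ b, ∃ c, e (Sum.inr b) = Sum.inl c := by
      intro b
      rcases h : e (Sum.inr a) with c | c
      · rcases h' : e (Sum.inr b) with d | d
        · exact ⟨d, rfl⟩
        · exfalso
          by_cases hab : a = b
          · subst hab; rw [h] at h'; cases h'
          · have := hom (Sum.inr a) (Sum.inr b) hab
            rw [h, h'] at this
            exact this
      · exact absurd h (ha c)
    choose c hc using hall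
    have hadj : ∀ a b, a ≠ b → gadj n (Sum.inl (c a)) (Sum.inl (c b)) := by
      intro a b hab
      rw [← hc, ← hc]
      exact hom _ _ hab
    have h01 := hadj ⟨0, by omega⟩ ⟨1, by omega⟩ (by simp)
    have h12 := hadj ⟨1, by omega⟩ ⟨2, by omega⟩ (by simp)
    have h20 := hadj ⟨2, by omega⟩ ⟨0, by omega⟩ (by simp)
    exact no_triangle (l := 2*n+5) (by omega) _ _ _ h01 h12 h20 (by omega)
  choose φ hφ using hK
  have hinj : Function.Injective φ := by
    intro a b hab
    by_contra hne
    have := hom (Sum.inr a) (Sum.inr b) hne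
    rw [hφ, hφ] at this
    exact this hab
  have hle : m ≤ n := by
    have := Fintype.card_le_of_injective φ hinj
    simp at this
    omega
  rintro u v huv ⟨hu, hv⟩
  rcases u with u | u
  · rcases v with v | v
    · -- whole cycle maps into the cycle
      have hstart : ∃ c, e (Sum.inl u) = Sum.inl c := by
        rcases h : e (Sum.inl u) with c | c
        · exact ⟨c, rfl⟩
        · simp [h, Gt] at hu
      have hstep : ∀ i, (∃ c, e (Sum.inl i) = Sum.inl c) → ∃ c, e (Sum.inl (i+1)) = Sum.inl c := by
        rintro i ⟨c, hc⟩
        have := hom (Sum.inl i) (Sum.inl (i+1)) (Or.inl rfl)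
        rw [hc] at this
        rcases h : e (Sum.inl (i+1)) with d | d
        · exact ⟨d, rfl⟩
        · rw [h] at this; exact this.elim
      have hall' : ∀ k : ℕ, ∃ c, e (Sum.inl (u + k)) = Sum.inl c := by
        intro k
        induction k with
        | zero => simpa using hstart
        | succ k ih =>
          have := hstep _ ih
          push_cast
          rwa [← add_assoc]
      have hall : ∀ i, ∃ c, e (Sum.inl i) = Sum.inl c := by
        intro i
        have := hall' (i - u).val
        rw [ZMod.natCast_val, ZMod.cast_id] at this
        simpa using this
      choose c hc using hall
      have := cycle_hom (k := 2*m+5) (l := 2*n+5) (by omega) (by omega) c (by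
        intro i
        have := hom (Sum.inl i) (Sum.inl (i+1)) (Or.inl rfl)
        rw [hc, hc] at this
        exact this) (by omega)
      omega
    · exact huv
  · simp [hφ, Gt] at hu

theorem continuum_T02 {C : Set (PF Bool)} (hC : IsClone C)
    (h : ∀ n (F : (Fin (n+1) → Bool) → Bool), tot F ∈ C → IsT02 F) :
    Cardinal.continuum ≤ Cardinal.mk ↥(Istr C) := by
  classical
  have hsing : ∀ n (u : GV n), ∃ x ∈ GA n, x u = true ∧ ∀ v ≠ u, x v = false := by
    intro n u
    refine ⟨fun w => decide (w = u), ?_, by simp, fun v hv => by simp [hv]⟩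
    rintro a b hab ⟨ha, hb⟩
    simp only [decide_eq_true_eq] at ha hb
    subst ha; subst hb
    exact gadj_irrefl _ hab
  refine continuum_of hC GV GA Gt ?_ ?_ ?_ ?_ ?_ ?_
  · intro n v w hvw
    obtain ⟨x, hx, h1, h2⟩ := hsing n v
    by_contra hne
    have := hvw x hx
    rw [h1, h2 w (Ne.symm hne)] at this
    cases this
  · intro n
    exact ⟨_, (hsing n (Sum.inl 0)).choose_spec.1⟩
  · intro n
    apply GPres_tot hC
    rintro k F hF M hM u v huv ⟨hu, hv⟩
    obtain ⟨i, h1, h2⟩ := h k F hF _ _ hu hv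
    exact hM i u v huv ⟨h1, h2⟩
  · intro m n hmn e he
    exact G_indep hmn e he
  · intro n hn
    exact hn (Sum.inl 0) (Sum.inl 1) (by simp [gadj]) ⟨rfl, rfl⟩
  · intro n m E hE
    exfalso
    obtain ⟨x, hx, h1, h2⟩ := hsing n (E (fun _ => false))
    obtain ⟨i, hi, _⟩ := h m _ (hE x hx) (fun _ => false) (fun _ => false) h1 h1
    cases hi

/-! ### the family for meet-homomorphisms -/

abbrev MV (n : ℕ) : Type := Option (Fin (n+4))

def MA (n : ℕ) : Set (MV n → Bool) :=
  {x | ((∀ j, x (some j) = true) → x none = true) ∧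
    ∀ i j1 j2, j1 ≠ j2 → x none = true → x (some j1) = true → x (some j2) = true → x (some i) = true}

def Mt (n : ℕ) : MV n → Bool
  | none => false
  | some _ => true

theorem MA_del {n : ℕ} (l : Fin (n+4)) :
    (fun v : MV n => match v with | none => false | some j => decide (j ≠ l)) ∈ MA n := by
  refine ⟨?_, ?_⟩
  · intro h
    have := h l
    simp at this
  · intro i j1 j2 _ h
    simp at h

theorem MA_one {n : ℕ} (l : Fin (n+4)) :
    (fun v : MV n => match v with | none => true | some j => decide (j = l)) ∈ MA n := by
  refine ⟨fun _ => rfl, ?_⟩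
  intro i j1 j2 h _ h1 h2
  simp at h1 h2
  exact absurd (h1.trans h2.symm) h

theorem MA_single {n : ℕ} (l : Fin (n+4)) :
    (fun v : MV n => match v with | none => false | some j => decide (j = l)) ∈ MA n := by
  refine ⟨?_, ?_⟩
  · intro h
    by_cases hl : l = 0
    · have := h 1
      subst hl
      simp at this
    · have := h 0
      simp at this
      exact absurd this.symm hl
  · intro i j1 j2 _ h
    simp at h

theorem MA_zero {n : ℕ} : (fun v : MV n => match v with | none => true | some _ => false) ∈ MA n := by
  refine ⟨fun _ => rfl, ?_⟩
  intro i j1 j2 h _ h1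
  simp at h1

theorem MA_anti {n : ℕ} {v w : MV n} (h : ∀ x ∈ MA n, x w = true → x v = true) : w = v := by
  rcases w with _ | w
  · rcases v with _ | v
    · rfl
    · have := h _ MA_zero
      simp at this
  · have := h _ (MA_single w)
    rcases v with _ | v
    · simp at this
    · simp at this
      rw [this]

theorem IsMeet.mono {κ : Type} {F : (κ → Bool) → Bool} (h : IsMeet F) {a b : κ → Bool}
    (hab : ∀ i, a i = true → b i = true) (ha : F a = true) : F b = true := by
  have h1 := h a b
  have h2 : (fun i => a i && b i) = a := by
    funext i
    have := hab i
    cases h : a i <;> simp_all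
  rw [h2, ha] at h1
  simpa using h1

theorem IsMeet.fin {κ J : Type} {F : (κ → Bool) → Bool} (h : IsMeet F) (M : J → κ → Bool)
    {s : Finset J} (hs : s.Nonempty) : (∀ j ∈ s, F (M j) = true) →
    ∃ b, F b = true ∧ ∀ c, b c = true → ∀ j ∈ s, M j c = true := by
  classical
  induction hs using Finset.Nonempty.cons_induction with
  | singleton a => 
    intro h
    exact ⟨M a, h a (by simp), by simp⟩
  | cons a s ha hs ih =>
    intro h2
    obtain ⟨b, hb, hb2⟩ := ih (fun j hj => h2 j (by simp [hj]))
    refine ⟨fun c => M a c && b c, ?_, ?_⟩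
    · rw [h, hb, h2 a (by simp)]; rfl
    · intro c hc j hj
      simp only [Bool.and_eq_true] at hc
      rcases Finset.mem_cons.1 hj with rfl | hj
      · exact hc.1
      · exact hb2 c hc.2 j hj

theorem Mt_some {n : ℕ} {v : MV n} (h : Mt n v = true) : ∃ a, v = some a := by
  cases v with
  | none => simp [Mt] at h
  | some a => exact ⟨a, rfl⟩

theorem Mt_none {n : ℕ} {v : MV n} (h : ¬ Mt n v = true) : v = none := by
  cases v with
  | none => rfl
  | some a => simp [Mt] at h

theorem M_indep {m n : ℕ} (hmn : m ≠ n) (e : MV m → MV n)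
    (he : ∀ x ∈ MA n, (fun w => x (e w)) ∈ MA m) : (fun w => Mt n (e w)) ∈ MA m := by
  refine ⟨?_, ?_⟩
  · intro h
    by_contra hcon
    have h0 := Mt_none hcon
    choose φ hφ using fun j => Mt_some (h j)
    have hsurj : Function.Surjective φ := by
      intro l
      by_contra hl
      push Not at hl
      have := (he _ (MA_del l)).1 (by
        intro j
        simp [hφ, hl])
      simp [h0] at this
    have hinj : Function.Injective φ := by
      intro j1 j2 hj
      by_contra hne
      have h2 : ∀ i, φ i = φ j1 := by
        intro i
        have := (he _ (MA_one (φ j1))).2 i j1 j2 hne (by simp [h0]) (by simp [hφ]) (by simp [hφ, hj])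
        simpa [hφ] using this
      obtain ⟨a, ha⟩ := hsurj 0
      obtain ⟨b, hb⟩ := hsurj 1
      rw [h2] at ha hb
      rw [ha] at hb
      simp at hb
    have := Fintype.card_of_bijective ⟨hinj, hsurj⟩
    simp at this
    exact hmn this
  · intro i j1 j2 hne h0 h1 h2
    by_contra hcon
    have h3 := Mt_none hcon
    obtain ⟨a, ha⟩ := Mt_some h0
    obtain ⟨b, hb⟩ := Mt_some h1
    obtain ⟨c, hc⟩ := Mt_some h2
    obtain ⟨l, hl⟩ : ∃ l, l ∉ ({a, b, c} : Finset (Fin (n+4))) := by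
      by_contra hall
      push Not at hall
      have h5 : (Finset.univ : Finset (Fin (n+4))) ⊆ {a, b, c} := fun x _ => hall x
      have := (Finset.card_le_card h5).trans Finset.card_le_three
      simp at this
    simp only [Finset.mem_insert, Finset.mem_singleton, not_or] at hl
    have := (he _ (MA_del l)).2 i j1 j2 hne (by simp [ha, Ne.symm hl.1])
      (by simp [hb, Ne.symm hl.2.1]) (by simp [hc, Ne.symm hl.2.2])
    simp [h3] at this

theorem continuum_Meet {C : Set (PF Bool)} (hC : IsClone C)
    (h : ∀ n (F : (Fin (n+1) → Bool) → Bool), tot F ∈ C → IsMeet F) :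
    Cardinal.continuum ≤ Cardinal.mk ↥(Istr C) := by
  classical
  refine continuum_of hC MV MA Mt ?_ ?_ ?_ ?_ ?_ ?_
  · intro n v w hvw
    exact MA_anti (fun x hx h => (hvw x hx).symm.trans h ▸ by simpa [hvw x hx] using h)
  · intro n
    exact ⟨_, MA_zero⟩
  · intro n
    apply GPres_tot hC
    intro k F hF M hM
    have hm := h k F hF
    refine ⟨?_, ?_⟩
    · intro hall
      obtain ⟨b, hb, hb2⟩ := hm.fin (fun j => M (some j)) (s := Finset.univ) ⟨0, by simp⟩ (fun j _ => hall j)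
      exact hm.mono (fun c hc => (hM c).1 (fun j => hb2 c hc j (by simp))) hb
    · intro i j1 j2 hne h0 h1 h2
      have e : F (fun c => (M none c && M (some j1) c) && M (some j2) c) = true := by
        rw [hm, hm]; simp only at h0 h1 h2; rw [h0, h1, h2]; rfl
      refine hm.mono (fun c hc => ?_) e
      simp only [Bool.and_eq_true] at hc
      exact (hM c).2 i j1 j2 hne hc.1.1 hc.1.2 hc.2
  · intro m n hmn e he
    exact M_indep hmn e he
  · intro n hn
    have := hn.1 (fun _ => rfl)
    simp [Mt] at this
  · intro n m E hE
    have hE2 : ∀ a b : Fin (m+1) → Bool, E (fun i => a i && b i) = E a := by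
      intro a b
      apply MA_anti
      intro x hx h1
      have := h m _ (hE x hx) a b
      simp only [h1] at this
      simp at this
      exact this.1
    have hE3 : ∀ a, E a = E (fun _ => false) := by
      intro a
      rw [← hE2 a (fun _ => false)]
      simp
    have : ∃ x ∈ MA n, x (E fun _ => false) = Mt n (E fun _ => false) := by
      rcases hv : E (fun _ => false) with _ | j
      · exact ⟨_, MA_del 0, by simp [Mt]⟩
      · exact ⟨_, MA_single j, by simp [Mt]⟩
    obtain ⟨x, hx, hx2⟩ := this
    exact ⟨x, hx, fun y => by rw [hE3 y, hx2]⟩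

/-! ### the family for affine functions -/

def x3 {κ : Type} (a b c : κ → Bool) : κ → Bool := fun i => xor (xor (a i) (b i)) (c i)

def wt {N : ℕ} (W : Fin N → Bool) : ℕ := (Finset.univ.filter (fun i => W i = true)).card

abbrev LV (p N : ℕ) : Type := {W : Fin N → Bool // wt W ≤ p ∨ W = fun _ => true}

def LA (p N : ℕ) : Set (LV p N → Bool) :=
  {x | ∃ X : (Fin N → Bool) → Bool, IsL X ∧ ∀ W, x W = X W.1}

def Lt (p N : ℕ) (W : LV p N) : Bool := decide (W.1 = fun _ => true)

theorem IsL_coord {κ : Type} (c : κ) : IsL (fun W : κ → Bool => W c) := fun _ _ _ => rfl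

theorem LA_coord {p N : ℕ} (c : Fin N) : (fun W : LV p N => W.1 c) ∈ LA p N :=
  ⟨fun W => W c, IsL_coord c, fun _ => rfl⟩

theorem LA_const {p N : ℕ} (b : Bool) : (fun _ : LV p N => b) ∈ LA p N :=
  ⟨fun _ => b, fun _ _ _ => by simp, fun _ => rfl⟩

theorem L_four {p N : ℕ} (hN : 3 * p < N) {U : Type} (op : U → U → U → U) (E : U → LV p N)
    (hE : ∀ a b c, (E (op a b c)).1 = x3 (E a).1 (E b).1 (E c).1) :
    ∃ x ∈ LA p N, ∀ y, Lt p N (E y) = x (E y) := by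
  by_cases h1 : ∃ y, (E y).1 = fun _ => true
  swap
  · push Not at h1
    exact ⟨_, LA_const false, fun y => by simp [Lt, h1 y]⟩
  by_cases h2 : ∀ y, (E y).1 = fun _ => true
  · exact ⟨_, LA_const true, fun y => by simp [Lt, h2 y]⟩
  push Not at h2
  obtain ⟨y1, hy1⟩ := h1
  obtain ⟨y0, hy0⟩ := h2
  obtain ⟨c, hc⟩ : ∃ c, (E y0).1 c = false := by
    by_contra hcon
    push Not at hcon
    exact hy0 (funext fun c => by simpa using hcon c)
  refine ⟨_, LA_coord c, fun y => ?_⟩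
  by_cases hy : (E y).1 = fun _ => true
  · simp [Lt, hy]
  · have hw0 := (E y0).2.resolve_right hy0
    have hw := (E y).2.resolve_right hy
    have h3 := hE y1 y0 y
    have hone : (E (op y1 y0 y)).1 = fun _ => true := by
      refine (E (op y1 y0 y)).2.resolve_left ?_
      intro hle
      rw [h3, hy1] at hle
      have hcov : (Finset.univ : Finset (Fin N)) ⊆
          (Finset.univ.filter (fun i => x3 (fun _ => true) (E y0).1 (E y).1 i = true)) ∪
          ((Finset.univ.filter (fun i => (E y0).1 i = true)) ∪
          (Finset.univ.filter (fun i => (E y).1 i = true))) := by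
        intro i _
        have hh : ∀ u v : Bool, xor (xor true u) v = true ∨ u = true ∨ v = true := by decide
        rcases hh ((E y0).1 i) ((E y).1 i) with h | h | h
        · exact Finset.mem_union_left _ (Finset.mem_filter.2 ⟨Finset.mem_univ _, h⟩)
        · exact Finset.mem_union_right _ (Finset.mem_union_left _ (Finset.mem_filter.2 ⟨Finset.mem_univ _, h⟩))
        · exact Finset.mem_union_right _ (Finset.mem_union_right _ (Finset.mem_filter.2 ⟨Finset.mem_univ _, h⟩))
      have h5 := Finset.card_le_card hcov
      have h6 := Finset.card_union_le (Finset.univ.filter (fun i => x3 (fun _ => true) (E y0).1 (E y).1 i = true)) ((Finset.univ.filter (fun i => (E y0).1 i = true)) ∪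
          (Finset.univ.filter (fun i => (E y).1 i = true)))
      have h7 := Finset.card_union_le (Finset.univ.filter (fun i => (E y0).1 i = true))
          (Finset.univ.filter (fun i => (E y).1 i = true))
      simp only [Finset.card_univ, Fintype.card_fin] at h5
      unfold wt at hw0 hw hle
      omega
    rw [hone, hy1] at h3
    have h4 := congrFun h3 c
    simp only [x3, hc] at h4
    have : (E y).1 c = false := by
      revert h4
      cases (E y).1 c <;> simp
    simp [Lt, hy, this]

theorem L_t {p N : ℕ} (hp : 1 ≤ p) (hN : 3 * p < N) : Lt p N ∉ LA p N := by
  classical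
  rintro ⟨X, hX, hX2⟩
  have hne : ∀ W : Fin N → Bool, wt W ≤ p → W ≠ fun _ => true := by
    rintro W hW rfl
    simp [wt] at hW
    omega
  have h0 : ∀ W : Fin N → Bool, wt W ≤ p → X W = false := by
    intro W hW
    rw [← hX2 ⟨W, Or.inl hW⟩]
    simp [Lt, hne W hW]
  have hs : ∀ s : Finset (Fin N), X (fun i => decide (i ∈ s)) = false := by
    intro s
    induction s using Finset.induction_on with
    | empty => apply h0; simp [wt]
    | insert a s ha ih =>
      have h1 := hX (fun i => decide (i ∈ s)) (fun i => decide (i = a)) (fun i => false)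
      rw [ih, h0 (fun i => decide (i = a)) (by simp [wt, Finset.filter_eq', hp]),
        h0 (fun i => false) (by simp [wt])] at h1
      refine (congrArg X ?_).trans h1
      funext i
      by_cases hi : i = a
      · subst hi; simp [ha]
      · simp [hi]
  have h1 := hs Finset.univ
  have h2 := hX2 ⟨fun _ => true, Or.inr rfl⟩
  simp [Lt] at h2
  simp [h2] at h1

theorem L_lt {p N p' N' : ℕ} (h : 2 ^ N * p' < N') (e : LV p N → LV p' N')
    (he : ∀ x ∈ LA p' N', (fun w => x (e w)) ∈ LA p N) : (fun w => Lt p' N' (e w)) ∈ LA p N := by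
  classical
  let S : LV p N → Finset (Fin N') := fun w => if (e w).1 = (fun _ => true) then ∅ else
    Finset.univ.filter (fun i => (e w).1 i = true)
  have hcard : (Finset.univ.biUnion S).card ≤ 2 ^ N * p' := by
    refine (Finset.card_biUnion_le_card_mul _ _ p' ?_).trans ?_
    · intro w _
      simp only [S]
      split_ifs with h1
      · simp
      · exact (e w).2.resolve_right h1
    · apply Nat.mul_le_mul_right
      rw [Finset.card_univ]
      refine (Fintype.card_subtype_le _).trans ?_
      simp
  obtain ⟨c, hc⟩ : ∃ c, c ∉ Finset.univ.biUnion S := by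
    by_contra hcon
    push Not at hcon
    have := Finset.card_le_card (fun x _ => hcon x : (Finset.univ : Finset (Fin N')) ⊆ _)
    simp only [Finset.card_univ, Fintype.card_fin] at this
    omega
  have := he _ (LA_coord c)
  convert this using 2 with w
  by_cases h1 : (e w).1 = (fun _ => true)
  · simp [Lt, h1]
  · have h2 : c ∉ S w := fun h => hc (Finset.mem_biUnion.2 ⟨w, by simp, h⟩)
    simp only [S, if_neg h1, Finset.mem_filter, Finset.mem_univ, true_and] at h2
    simp [Lt, h1, h2]

theorem L_small {N N' : ℕ} (g : (Fin N → Bool) → Fin N' → Bool)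
    (hg : ∀ a b c, g (x3 a b c) = x3 (g a) (g b) (g c)) (k : ℕ) :
    ∀ W, wt W ≤ k → ∃ W', wt W' ≤ N' ∧ g W' = g W := by
  classical
  induction k with
  | zero => intro W hW; exact ⟨W, by omega, rfl⟩
  | succ k ih =>
    intro W hW
    by_cases hle : wt W ≤ N'
    · exact ⟨W, hle, rfl⟩
    have hcard : (Finset.univ : Finset (Fin N' → Bool)).card <
        (Finset.univ.filter (fun i => W i = true)).powerset.card := by
      rw [Finset.card_powerset]
      simp only [Finset.card_univ, Fintype.card_fun, Fintype.card_bool, Fintype.card_fin]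
      apply Nat.pow_lt_pow_right (by omega)
      unfold wt at hle
      omega
    obtain ⟨S, hS, T, hT, hne, heq⟩ := Finset.exists_ne_map_eq_of_card_lt_of_maps_to hcard
      (f := fun S => g (fun i => decide (i ∈ S))) (fun _ _ => by simp)
    have hlt : wt (x3 W (fun i => decide (i ∈ S)) (fun i => decide (i ∈ T))) < wt W := by
      apply Finset.card_lt_card
      rw [Finset.mem_powerset] at hS hT
      obtain ⟨i, hi⟩ : ∃ i, ¬ (i ∈ S ↔ i ∈ T) := by
        by_contra hcon
        push Not at hcon
        exact hne (Finset.ext hcon)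
      rw [Finset.ssubset_iff_of_subset]
      · refine ⟨i, ?_, ?_⟩
        · by_cases h : i ∈ S
          · exact hS h
          · exact hT (by tauto)
        · have hW : W i = true := by
            by_cases h : i ∈ S
            · simpa using hS h
            · simpa using hT (by tauto : i ∈ T)
          simp only [x3, Finset.mem_filter, Finset.mem_univ, true_and, hW]
          by_cases h : i ∈ S <;> by_cases h' : i ∈ T <;> simp_all
      · intro j hj
        simp only [x3, Finset.mem_filter, Finset.mem_univ, true_and] at hj ⊢
        by_contra hWj
        have h1 : j ∉ S := fun h => hWj (by simpa using hS h)
        have h2 : j ∉ T := fun h => hWj (by simpa using hT h)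
        simp [h1, h2, hWj] at hj
    obtain ⟨W', h1, h2⟩ := ih _ (by omega : wt (x3 W (fun i => decide (i ∈ S)) (fun i => decide (i ∈ T))) ≤ k)
    refine ⟨W', h1, ?_⟩
    rw [h2, hg]
    rw [heq]
    funext i
    simp [x3]

theorem L_gt {p N p' N' : ℕ} (h3 : 3 * p' < N') (h : N' ≤ p) (e : LV p N → LV p' N')
    (he : ∀ x ∈ LA p' N', (fun w => x (e w)) ∈ LA p N) : (fun w => Lt p' N' (e w)) ∈ LA p N := by
  classical
  choose X hX hX2 using fun c => he _ (LA_coord c)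
  have hg : ∀ a b c, (fun W i => X i W) (x3 a b c) = x3 (fun i => X i a) (fun i => X i b) (fun i => X i c) := by
    intro a b c
    funext i
    exact hX i a b c
  have hmem : ∀ W, wt (fun i => X i W) ≤ p' ∨ (fun i => X i W) = fun _ => true := by
    intro W
    obtain ⟨W', h1, h2⟩ := L_small (fun W i => X i W) hg (wt W) W le_rfl
    rw [← h2]
    have : (fun i => X i W') = (e ⟨W', Or.inl (h1.trans h)⟩).1 := by
      funext i
      exact (hX2 i ⟨W', Or.inl (h1.trans h)⟩).symm
    rw [this]
    exact (e _).2
  obtain ⟨x, hx, hx2⟩ := L_four h3 x3 (fun W => (⟨_, hmem W⟩ : LV p' N')) hg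
  have := he x hx
  convert this using 2 with w
  have h5 : e w = ⟨_, hmem w.1⟩ := by
    apply Subtype.ext
    funext i
    exact hX2 i w
  rw [h5]
  exact hx2 w.1

def aseq : ℕ → ℕ
  | 0 => 1
  | n+1 => aseq n * (2 ^ aseq n + 5)

theorem aseq_pos (n : ℕ) : 1 ≤ aseq n := by
  induction n with
  | zero => simp [aseq]
  | succ n ih => simp only [aseq]; exact Nat.mul_pos ih (by positivity)

theorem aseq_three (n : ℕ) : 3 * aseq n < aseq (n+1) := by
  have := aseq_pos n
  simp only [aseq]
  nlinarith [Nat.zero_le (2 ^ aseq n)]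

theorem aseq_mono : Monotone aseq := monotone_nat_of_le_succ (fun n => by have := aseq_three n; omega)

theorem continuum_L {C : Set (PF Bool)} (hC : IsClone C)
    (h : ∀ n (F : (Fin (n+1) → Bool) → Bool), tot F ∈ C → IsL F) :
    Cardinal.continuum ≤ Cardinal.mk ↥(Istr C) := by
  classical
  refine continuum_of hC (fun n => LV (aseq n) (aseq (n+1))) (fun n => LA _ _) (fun n => Lt _ _) ?_ ?_ ?_ ?_ ?_ ?_
  · intro n v w hvw
    apply Subtype.ext
    funext c
    exact hvw _ (LA_coord c)
  · intro n
    exact ⟨_, LA_const true⟩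
  · intro n
    apply GPres_tot hC
    intro k F hF M hM
    choose X hX hX2 using hM
    refine ⟨fun W => F (fun j => X j W), ?_, ?_⟩
    · intro a b c
      rw [← h k F hF]
      exact congrArg F (funext fun j => hX j a b c)
    · intro W
      exact congrArg F (funext fun j => hX2 j W)
  · intro m n hmn e he
    rcases lt_or_gt_of_ne hmn with hlt | hlt
    · refine L_lt ?_ e he
      have h1 : aseq (m+1) ≤ aseq n := aseq_mono hlt
      have h2 : 2 ^ aseq (m+1) ≤ 2 ^ aseq n := Nat.pow_le_pow_right (by omega) h1
      have h3 := aseq_pos n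
      show _ < aseq n * (2 ^ aseq n + 5)
      nlinarith
    · exact L_gt (aseq_three n) (aseq_mono hlt) e he
  · intro n
    exact L_t (aseq_pos n) (aseq_three n)
  · intro n m E hE
    refine L_four (aseq_three n) x3 E ?_
    intro a b c
    funext i
    exact h m _ (hE _ (LA_coord i)) a b c

/-! ### duality -/

def dualFn {k : ℕ} (f : (Fin k → Bool) → Option Bool) : (Fin k → Bool) → Option Bool :=
  fun x => (f (fun i => !x i)).map not

def dualPF (f : PF Bool) : PF Bool := ⟨f.1, dualFn f.2⟩

def DD (X : Set (PF Bool)) : Set (PF Bool) := {f | dualPF f ∈ X}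

def dualT {κ : Type} (F : (κ → Bool) → Bool) : (κ → Bool) → Bool := fun x => !F (fun i => !x i)

theorem dualFn_dualFn {k : ℕ} (f : (Fin k → Bool) → Option Bool) : dualFn (dualFn f) = f := by
  funext x
  simp only [dualFn, Bool.not_not]
  cases f x <;> simp

theorem dualPF_dualPF (f : PF Bool) : dualPF (dualPF f) = f := by
  obtain ⟨n, f⟩ := f
  simp only [dualPF, dualFn_dualFn]
  rfl

theorem DD_DD (X : Set (PF Bool)) : DD (DD X) = X := by
  ext f
  simp [DD, dualPF_dualPF]

theorem dualFn_some {k : ℕ} {f : (Fin k → Bool) → Option Bool} {x : Fin k → Bool} {b : Bool} :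
    dualFn f x = some b ↔ f (fun i => !x i) = some (!b) := by
  unfold dualFn
  cases f (fun i => !x i) with
  | none => simp
  | some c => cases b <;> cases c <;> simp

theorem compFun_some_iff {k m : ℕ} {f : (Fin k → Bool) → Option Bool}
    {g : Fin k → ((Fin m → Bool) → Option Bool)} {x : Fin m → Bool} {b : Bool} :
    compFun f g x = some b ↔ ∃ y : Fin k → Bool, (∀ i, g i x = some (y i)) ∧ f y = some b := by
  refine ⟨compFun_some, ?_⟩
  rintro ⟨y, hy, hb⟩
  unfold compFun
  simp [hy, hb]

theorem dual_comp {k m : ℕ} (f : (Fin k → Bool) → Option Bool)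
    (g : Fin k → ((Fin m → Bool) → Option Bool)) :
    dualFn (compFun f g) = compFun (dualFn f) (fun i => dualFn (g i)) := by
  funext x
  apply Option.ext
  intro b
  rw [dualFn_some, compFun_some_iff, compFun_some_iff]
  constructor
  · rintro ⟨y, hy, hb⟩
    exact ⟨fun i => !y i, fun i => by rw [dualFn_some, hy]; simp, by rw [dualFn_some]; simpa using hb⟩
  · rintro ⟨y, hy, hb⟩
    exact ⟨fun i => !y i, fun i => by rw [← dualFn_some, hy], by rwa [← dualFn_some]⟩

theorem DD_partial {X : Set (PF Bool)} (hX : IsPartialClone X) : IsPartialClone (DD X) := by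
  refine ⟨?_, ?_⟩
  · intro n i
    have h := hX.1 n i
    have : dualPF (proj n i) = proj n i := by
      simp only [dualPF, proj]
      congr
      funext x
      simp [dualFn]
    show dualPF _ ∈ X
    rw [this]; exact h
  · intro f hf m g hg
    have := hX.2 (dualPF f) hf m (fun i => dualFn (g i)) hg
    show (⟨m, dualFn (compFun f.2 g)⟩ : PF Bool) ∈ X
    rw [dual_comp]
    exact this

theorem dual_O {f : PF Bool} : dualPF f ∈ OSet Bool ↔ f ∈ OSet Bool := by
  constructor
  · intro h x
    have := h (fun i => !x i)
    simpa [dualPF, dualFn] using this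
  · intro h x
    simpa [dualPF, dualFn] using h _

theorem DD_clone {X : Set (PF Bool)} (hX : IsClone X) : IsClone (DD X) :=
  ⟨DD_partial hX.1, fun _ hf => dual_O.1 (hX.2 hf)⟩

theorem DD_Istr {C X : Set (PF Bool)} (hX : X ∈ Istr C) : DD X ∈ Istr (DD C) := by
  obtain ⟨h1, h2, h3⟩ := hX
  refine ⟨DD_partial h1, ?_, ?_⟩
  · apply strong_of
    intro n f g hg hfg
    refine strong_elim h2 (g := dualFn g) hg ?_
    intro x a h
    exact dualFn_some.2 (hfg _ _ (dualFn_some.1 h))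
  · ext f
    have := Set.ext_iff.1 h3 (dualPF f)
    show dualPF f ∈ X ∧ f ∈ OSet Bool ↔ dualPF f ∈ C
    rw [← dual_O]
    exact this

theorem continuum_dual {C : Set (PF Bool)} (h : Cardinal.continuum ≤ Cardinal.mk ↥(Istr (DD C))) :
    Cardinal.continuum ≤ Cardinal.mk ↥(Istr C) := by
  refine h.trans ?_
  refine Cardinal.mk_le_of_injective (f := fun X => (⟨DD X.1, by
    have := DD_Istr X.2
    rwa [DD_DD] at this⟩ : ↥(Istr C))) ?_
  intro X Y hXY
  have := congrArg (fun Z => DD Z.1) hXY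
  simp only [DD_DD] at this
  exact Subtype.ext this

theorem dual_tot {n : ℕ} (F : (Fin (n+1) → Bool) → Bool) : dualPF (tot F) = tot (dualT F) := by
  rfl

theorem dualT_dualT {κ : Type} (F : (κ → Bool) → Bool) : dualT (dualT F) = F := by
  funext x; simp [dualT]

theorem tot_DD {C : Set (PF Bool)} {n : ℕ} (F : (Fin (n+1) → Bool) → Bool) :
    tot F ∈ DD C ↔ tot (dualT F) ∈ C := by
  show dualPF _ ∈ C ↔ _
  rw [dual_tot]

theorem TM_DD {C : Set (PF Bool)} {κ : Type} (F : (κ → Bool) → Bool) :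
    TM (DD C) F ↔ TM C (dualT F) := by
  unfold TM
  simp only [tot_DD]
  rfl

theorem IsT02_dual {κ : Type} {F : (κ → Bool) → Bool} (h : IsT12 F) : IsT02 (dualT F) := by
  intro a b ha hb
  obtain ⟨i, h1, h2⟩ := h (fun i => !a i) (fun i => !b i) (by simpa [dualT] using ha) (by simpa [dualT] using hb)
  exact ⟨i, by simpa using h1, by simpa using h2⟩

theorem IsT12_dual {κ : Type} {F : (κ → Bool) → Bool} (h : IsT02 F) : IsT12 (dualT F) := by
  intro a b ha hb
  obtain ⟨i, h1, h2⟩ := h (fun i => !a i) (fun i => !b i) (by simpa [dualT] using ha) (by simpa [dualT] using hb)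
  exact ⟨i, by simpa using h1, by simpa using h2⟩

theorem IsMeet_dual {κ : Type} {F : (κ → Bool) → Bool} (h : IsJoin F) : IsMeet (dualT F) := by
  intro a b
  have := h (fun i => !a i) (fun i => !b i)
  simp only [dualT, Bool.not_and, this, Bool.not_or]

theorem IsJoin_dual {κ : Type} {F : (κ → Bool) → Bool} (h : IsMeet F) : IsJoin (dualT F) := by
  intro a b
  have := h (fun i => !a i) (fun i => !b i)
  simp only [dualT, Bool.not_or, this, Bool.not_and]

theorem IsL_dual {κ : Type} {F : (κ → Bool) → Bool} (h : IsL F) : IsL (dualT F) := by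
  intro a b c
  have := h (fun i => !a i) (fun i => !b i) (fun i => !c i)
  simp only [dualT]
  have e : (fun i => !(xor (xor (a i) (b i)) (c i))) = (fun i => xor (xor (!a i) (!b i)) (!c i)) := by
    funext i
    cases a i <;> cases b i <;> cases c i <;> rfl
  rw [e, this]
  cases F (fun i => !a i) <;> cases F (fun i => !b i) <;> cases F (fun i => !c i) <;> rfl

theorem continuum_T12 {C : Set (PF Bool)} (hC : IsClone C)
    (h : ∀ n (F : (Fin (n+1) → Bool) → Bool), tot F ∈ C → IsT12 F) :
    Cardinal.continuum ≤ Cardinal.mk ↥(Istr C) := by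
  apply continuum_dual
  apply continuum_T02 (DD_clone hC)
  intro n F hF
  rw [← dualT_dualT F]
  exact IsT02_dual (h n _ (tot_DD F |>.1 hF))

theorem continuum_Join {C : Set (PF Bool)} (hC : IsClone C)
    (h : ∀ n (F : (Fin (n+1) → Bool) → Bool), tot F ∈ C → IsJoin F) :
    Cardinal.continuum ≤ Cardinal.mk ↥(Istr C) := by
  apply continuum_dual
  apply continuum_Meet (DD_clone hC)
  intro n F hF
  rw [← dualT_dualT F]
  exact IsMeet_dual (h n _ (tot_DD F |>.1 hF))

def maj3 (a b c : Bool) : Bool := (a && b) || (a && c) || (b && c)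
def min3 (a b c : Bool) : Bool := xor (xor a b) c
def dd3 (a b c : Bool) : Bool := maj3 a b (!c)

theorem baker_pixley {V : Type} [Finite V] {ρ : Set (V → Bool)} (hne : ρ.Nonempty)
    (hmaj : ∀ x ∈ ρ, ∀ y ∈ ρ, ∀ z ∈ ρ, (fun i => maj3 (x i) (y i) (z i)) ∈ ρ)
    (t : V → Bool) (ht : ∀ i j, ∃ x ∈ ρ, x i = t i ∧ x j = t j) : t ∈ ρ := by
  classical
  have := Fintype.ofFinite V
  have key : ∀ n : ℕ, ∀ s : Finset V, s.card = n → ∃ x ∈ ρ, ∀ i ∈ s, x i = t i := by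
    intro n
    induction n using Nat.strong_induction_on with
    | _ n ih =>
      intro s hs
      rcases Nat.lt_or_ge 2 s.card with h | h
      · obtain ⟨a, b, c, ha, hb, hc, hab, hac, hbc⟩ := Finset.two_lt_card_iff.1 h
        have h1 : ∀ u ∈ s, ∃ x ∈ ρ, ∀ i ∈ s, i ≠ u → x i = t i := by
          intro u hu
          obtain ⟨x, hx, hx2⟩ := ih (s.erase u).card (by rw [← hs]; exact Finset.card_erase_lt_of_mem hu) _ rfl
          exact ⟨x, hx, fun i hi hiu => hx2 i (Finset.mem_erase.2 ⟨hiu, hi⟩)⟩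
        obtain ⟨x, hx, hx2⟩ := h1 a ha
        obtain ⟨y, hy, hy2⟩ := h1 b hb
        obtain ⟨z, hz, hz2⟩ := h1 c hc
        refine ⟨_, hmaj x hx y hy z hz, fun i hi => ?_⟩
        have m1 : ∀ p q : Bool, maj3 p q q = q := by decide
        have m2 : ∀ p q : Bool, maj3 q p q = q := by decide
        have m3 : ∀ p q : Bool, maj3 q q p = q := by decide
        by_cases hia : i = a
        · subst hia
          rw [hy2 i hi hab, hz2 i hi hac, m1]
        · by_cases hib : i = b
          · subst hib
            rw [hx2 i hi hia, hz2 i hi hbc, m2]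
          · rw [hx2 i hi hia, hy2 i hi hib, m3]
      · rcases Finset.eq_empty_or_nonempty s with rfl | ⟨a, ha⟩
        · obtain ⟨x, hx⟩ := hne
          exact ⟨x, hx, by simp⟩
        · by_cases hb : ∃ b ∈ s, b ≠ a
          · obtain ⟨b, hb, hba⟩ := hb
            obtain ⟨x, hx, h1, h2⟩ := ht a b
            refine ⟨x, hx, fun i hi => ?_⟩
            by_contra hcon
            have hia : i ≠ a := by rintro rfl; exact hcon h1
            have hib : i ≠ b := by rintro rfl; exact hcon h2
            have := Finset.two_lt_card_iff.2 ⟨a, b, i, ha, hb, hi, hba.symm, hia.symm, hib.symm⟩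
            omega
          · push Not at hb
            obtain ⟨x, hx, h1, h2⟩ := ht a a
            exact ⟨x, hx, fun i hi => by rw [hb i hi]; exact h1⟩
  obtain ⟨x, hx, hx2⟩ := key _ Finset.univ rfl
  have : x = t := funext fun i => hx2 i (by simp)
  exact this ▸ hx

def Has0 (C : Set (PF Bool)) (u : Bool) : Prop :=
  ∀ n, tot (fun _ : Fin (n+1) → Bool => u) ∈ C
def Has1 (C : Set (PF Bool)) (u : Bool → Bool) : Prop :=
  ∀ n (G : (Fin (n+1) → Bool) → Bool), tot G ∈ C → tot (fun x => u (G x)) ∈ C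
def Has2 (C : Set (PF Bool)) (u : Bool → Bool → Bool) : Prop :=
  ∀ n (G H : (Fin (n+1) → Bool) → Bool), tot G ∈ C → tot H ∈ C → tot (fun x => u (G x) (H x)) ∈ C
def Has3 (C : Set (PF Bool)) (u : Bool → Bool → Bool → Bool) : Prop :=
  ∀ n (G H K : (Fin (n+1) → Bool) → Bool), tot G ∈ C → tot H ∈ C → tot K ∈ C →
    tot (fun x => u (G x) (H x) (K x)) ∈ C
def Has4 (C : Set (PF Bool)) (u : Bool → Bool → Bool → Bool → Bool) : Prop :=
  ∀ n (G H K L : (Fin (n+1) → Bool) → Bool), tot G ∈ C → tot H ∈ C → tot K ∈ C → tot L ∈ C →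
    tot (fun x => u (G x) (H x) (K x) (L x)) ∈ C

theorem Has1_of {C : Set (PF Bool)} (hC : IsClone C) {k : ℕ} {F : (Fin (k+1) → Bool) → Bool}
    (hF : tot F ∈ C) (T : Fin (k+1) → Bool → Bool) (hT : ∀ i, Has1 C (T i)) :
    Has1 C (fun x => F (fun i => T i x)) :=
  fun n _ hG => comp_tot hC.1 hF (fun i => hT i n _ hG)
theorem Has2_of {C : Set (PF Bool)} (hC : IsClone C) {k : ℕ} {F : (Fin (k+1) → Bool) → Bool}
    (hF : tot F ∈ C) (T : Fin (k+1) → Bool → Bool → Bool) (hT : ∀ i, Has2 C (T i)) :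
    Has2 C (fun x y => F (fun i => T i x y)) :=
  fun n _ _ hG hH => comp_tot hC.1 hF (fun i => hT i n _ _ hG hH)
theorem Has3_of {C : Set (PF Bool)} (hC : IsClone C) {k : ℕ} {F : (Fin (k+1) → Bool) → Bool}
    (hF : tot F ∈ C) (T : Fin (k+1) → Bool → Bool → Bool → Bool) (hT : ∀ i, Has3 C (T i)) :
    Has3 C (fun x y z => F (fun i => T i x y z)) :=
  fun n _ _ _ hG hH hK => comp_tot hC.1 hF (fun i => hT i n _ _ _ hG hH hK)
theorem Has4_of {C : Set (PF Bool)} (hC : IsClone C) {k : ℕ} {F : (Fin (k+1) → Bool) → Bool}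
    (hF : tot F ∈ C) (T : Fin (k+1) → Bool → Bool → Bool → Bool → Bool) (hT : ∀ i, Has4 C (T i)) :
    Has4 C (fun x y z w => F (fun i => T i x y z w)) :=
  fun n _ _ _ _ hG hH hK hL => comp_tot hC.1 hF (fun i => hT i n _ _ _ _ hG hH hK hL)

/-- monotone idempotent functions are generated by meet and join -/
theorem gen_M {C : Set (PF Bool)} (hC : IsClone C) (ha : Has2 C and) (ho : Has2 C or)
    {n : ℕ} (F : (Fin (n+1) → Bool) → Bool)
    (h0 : F (fun _ => false) = false) (h1 : F (fun _ => true) = true)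
    (hm : ∀ a b, (∀ i, a i = true → b i = true) → F a = true → F b = true) : tot F ∈ C := by
  have hex : ∀ a, F a = true → ∃ i, a i = true := by
    intro a h
    by_contra hcon
    push Not at hcon
    have : a = fun _ => false := funext fun i => by simpa using hcon i
    rw [this, h0] at h; cases h
  have hex' : ∀ a, F a = false → ∃ i, a i = false := by
    intro a h
    by_contra hcon
    push Not at hcon
    have : a = fun _ => true := funext fun i => by simpa using hcon i
    rw [this, h1] at h; cases h
  have hsep : ∀ a b, F a = true → F b = false → ∃ i, a i = true ∧ b i = false := by
    intro a b h1 h2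
    by_contra hcon
    push Not at hcon
    have := hm a b (fun i hi => by simpa using hcon i hi) h1
    rw [h2] at this; cases this
  refine baker_pixley (ρ := {G | tot G ∈ C}) ⟨_, tot_proj hC.1 0⟩ ?_ F ?_
  · intro x hx y hy z hz
    exact ho _ _ _ (ho _ _ _ (ha _ _ _ hx hy) (ha _ _ _ hx hz)) (ha _ _ _ hy hz)
  · intro a b
    cases h2 : F a <;> cases h3 : F b
    · obtain ⟨i, hi⟩ := hex' a h2
      obtain ⟨j, hj⟩ := hex' b h3
      exact ⟨_, ha _ _ _ (tot_proj hC.1 i) (tot_proj hC.1 j), by simp [hi], by simp [hj]⟩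
    · obtain ⟨i, hi, hj⟩ := hsep b a h3 h2
      exact ⟨_, tot_proj hC.1 i, hj, hi⟩
    · obtain ⟨i, hi, hj⟩ := hsep a b h2 h3
      exact ⟨_, tot_proj hC.1 i, hi, hj⟩
    · obtain ⟨i, hi⟩ := hex a h2
      obtain ⟨j, hj⟩ := hex b h3
      exact ⟨_, ho _ _ _ (tot_proj hC.1 i) (tot_proj hC.1 j), by simp [hi], by simp [hj]⟩

/-- self-dual idempotent functions are generated by majority and minority -/
theorem gen_S {C : Set (PF Bool)} (hC : IsClone C) (hma : Has3 C maj3) (hmi : Has3 C min3)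
    {n : ℕ} (F : (Fin (n+1) → Bool) → Bool)
    (h0 : F (fun _ => false) = false) (h1 : F (fun _ => true) = true)
    (hs : ∀ a, F (fun i => !a i) = !F a) : tot F ∈ C := by
  have hc : ∀ c, F (fun _ => c) = c := by intro c; cases c <;> assumption
  have hex : ∀ a, ∃ i, a i = F a := by
    intro a
    by_contra hcon
    push Not at hcon
    have : a = fun _ => !F a := funext fun i => by
      have := hcon i
      revert this
      cases a i <;> cases F a <;> simp
    have h2 := hc (!F a)
    rw [← this] at h2
    simp at h2
  refine baker_pixley (ρ := {G | tot G ∈ C}) ⟨_, tot_proj hC.1 0⟩ ?_ F ?_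
  · intro x hx y hy z hz
    exact hma _ _ _ _ hx hy hz
  · intro a b
    by_cases hp : ∃ i, a i = F a ∧ b i = F b
    · obtain ⟨i, hi⟩ := hp
      exact ⟨_, tot_proj hC.1 i, hi⟩
    push Not at hp
    obtain ⟨i, hi⟩ := hex a
    obtain ⟨j, hj⟩ := hex b
    have hib := hp i hi
    have hja : a j ≠ F a := fun h => hp j h hj
    obtain ⟨k, hka, hkb⟩ : ∃ k, a k ≠ F a ∧ b k ≠ F b := by
      by_contra hcon
      push Not at hcon
      by_cases hab : F a = F b
      · have : b = fun i => !a i := by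
          funext k
          have e : ∀ p q r s : Bool, r = s → (p = r → q ≠ s) → (p ≠ r → q = s) → q = !p := by decide
          exact e _ _ _ _ hab (hp k) (hcon k)
        have h2 := hs a
        rw [← this, ← hab] at h2
        simp at h2
      · have : a = b := by
          funext k
          have e : ∀ p q r s : Bool, r ≠ s → (p = r → q ≠ s) → (p ≠ r → q = s) → p = q := by decide
          exact e _ _ _ _ hab (hp k) (hcon k)
        rw [this] at hab
        exact hab rfl
    refine ⟨_, hmi _ _ _ _ (tot_proj hC.1 i) (tot_proj hC.1 j) (tot_proj hC.1 k), ?_, ?_⟩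
    · have e : ∀ p q r s : Bool, p = s → q ≠ s → r ≠ s → min3 p q r = s := by decide
      exact e _ _ _ _ hi hja hka
    · have e : ∀ p q r s : Bool, p ≠ s → q = s → r ≠ s → min3 p q r = s := by decide
      exact e _ _ _ _ hib hj hkb

/-- pick a term according to the pattern of two tuples -/
def pick (a b : Bool) {T : Type} (t00 t01 t10 t11 : T) : T :=
  match a, b with
  | false, false => t00
  | false, true => t01
  | true, false => t10
  | true, true => t11

theorem pick_prop {T : Type} {P : T → Prop} {t00 t01 t10 t11 : T} (a b : Bool) (h00 : P t00)
    (h01 : P t01) (h10 : P t10) (h11 : P t11) : P (pick a b t00 t01 t10 t11) := by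
  cases a <;> cases b <;> assumption

theorem has_fst {C : Set (PF Bool)} : Has2 C (fun x _ => x) := fun _ _ _ hG _ => hG
theorem has_snd {C : Set (PF Bool)} : Has2 C (fun _ y => y) := fun _ _ _ _ hH => hH
theorem has_c2 {C : Set (PF Bool)} {c : Bool} (h : Has0 C c) : Has2 C (fun _ _ => c) :=
  fun n _ _ _ _ => h n
theorem has_id {C : Set (PF Bool)} : Has1 C (fun x => x) := fun _ _ hG => hG
theorem has_c1 {C : Set (PF Bool)} {c : Bool} (h : Has0 C c) : Has1 C (fun _ => c) :=
  fun n _ _ => h n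

theorem Has0_of {C : Set (PF Bool)} (hC : IsClone C) {c : Bool} (h : Has1 C (fun _ => c)) : Has0 C c :=
  fun n => h n _ (tot_proj hC.1 0)

theorem fn1_eq (u : Bool → Bool) : u = (fun x => if x then u true else u false) := by
  funext x; cases x <;> rfl

theorem odd2 {C : Set (PF Bool)} (hn : Has1 C not) {u : Bool → Bool → Bool} (hu : Has2 C u)
    (ho : xor (xor (u false false) (u true false)) (xor (u false true) (u true true)) = true) :
    Has2 C and ∧ Has2 C or := by
  have key : ∃ α β γ : Bool, ∀ x y, (x && y) = xor γ (u (xor x α) (xor y β)) := by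
    have up : ∀ x y, u x y = pick x y (u false false) (u false true) (u true false) (u true true) := by
      intro x y; cases x <;> cases y <;> rfl
    have hk : ∀ p q r s : Bool, xor (xor p q) (xor r s) = true →
        ∃ α β γ : Bool, ∀ x y, (x && y) = xor γ (pick (xor x α) (xor y β) p r q s) := by decide
    obtain ⟨α, β, γ, h⟩ := hk _ _ _ _ ho
    refine ⟨α, β, γ, fun x y => ?_⟩
    rw [up]; exact h x y
  obtain ⟨α, β, γ, h⟩ := key
  have hx : ∀ c, Has1 C (fun x => xor x c) := by
    intro c
    cases c
    · simpa using has_id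
    · simpa using hn
  have hand : Has2 C and := by
    have : and = fun x y => xor (u (xor x α) (xor y β)) γ := by
      funext x y
      rw [h x y, Bool.xor_comm]
    rw [this]
    intro n G H hG hH
    exact hx γ _ _ (hu _ _ _ (hx α _ _ hG) (hx β _ _ hH))
  refine ⟨hand, ?_⟩
  have : or = fun x y => !((!x) && (!y)) := by
    funext x y; cases x <;> cases y <;> rfl
  rw [this]
  intro n G H hG hH
  exact hn _ _ (hand _ _ _ (hn _ _ hG) (hn _ _ hH))

def MonoF {κ : Type} (F : (κ → Bool) → Bool) : Prop :=
  ∀ a b, (∀ i, a i = true → b i = true) → F a = true → F b = true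

theorem fn2_eq {u v : Bool → Bool → Bool} (h1 : u false false = v false false)
    (h2 : u false true = v false true) (h3 : u true false = v true false)
    (h4 : u true true = v true true) : u = v := by
  funext x y; cases x <;> cases y <;> assumption

theorem Has2_congr {C : Set (PF Bool)} {u v : Bool → Bool → Bool} (hu : Has2 C u)
    (h1 : u false false = v false false)
    (h2 : u false true = v false true) (h3 : u true false = v true false)
    (h4 : u true true = v true true) : Has2 C v := fn2_eq h1 h2 h3 h4 ▸ hu

theorem exJoin {C : Set (PF Bool)} (hJ : ¬ ∀ n (F : (Fin (n+1) → Bool) → Bool), tot F ∈ C → IsJoin F)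
    (hm : ∀ n (F : (Fin (n+1) → Bool) → Bool), tot F ∈ C → MonoF F) :
    ∃ (n : ℕ) (F : (Fin (n+1) → Bool) → Bool) (a b : Fin (n+1) → Bool), tot F ∈ C ∧
      F a = false ∧ F b = false ∧ F (fun i => a i || b i) = true := by
  push Not at hJ
  obtain ⟨n, F, hF, h⟩ := hJ
  unfold IsJoin at h
  push Not at h
  obtain ⟨a, b, h⟩ := h
  have h1 := hm n F hF a (fun i => a i || b i) (fun i hi => by simp [hi])
  have h2 := hm n F hF b (fun i => a i || b i) (fun i hi => by simp [hi])
  refine ⟨n, F, a, b, hF, ?_⟩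
  revert h h1 h2
  cases F a <;> cases F b <;> cases F (fun i => a i || b i) <;> simp

theorem exMeet {C : Set (PF Bool)} (hJ : ¬ ∀ n (F : (Fin (n+1) → Bool) → Bool), tot F ∈ C → IsMeet F)
    (hm : ∀ n (F : (Fin (n+1) → Bool) → Bool), tot F ∈ C → MonoF F) :
    ∃ (n : ℕ) (F : (Fin (n+1) → Bool) → Bool) (a b : Fin (n+1) → Bool), tot F ∈ C ∧
      F a = true ∧ F b = true ∧ F (fun i => a i && b i) = false := by
  push Not at hJ
  obtain ⟨n, F, hF, h⟩ := hJ
  unfold IsMeet at h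
  push Not at h
  obtain ⟨a, b, h⟩ := h
  have h1 := hm n F hF (fun i => a i && b i) a (fun i hi => by simp at hi; exact hi.1)
  have h2 := hm n F hF (fun i => a i && b i) b (fun i hi => by simp at hi; exact hi.2)
  refine ⟨n, F, a, b, hF, ?_⟩
  revert h h1 h2
  cases F a <;> cases F b <;> cases F (fun i => a i && b i) <;> simp

theorem caseA {C : Set (PF Bool)} (hC : IsClone C) (c0 : Has0 C false) (c1 : Has0 C true)
    (hL : ¬ ∀ n (F : (Fin (n+1) → Bool) → Bool), tot F ∈ C → IsL F)
    (hM : ¬ ∀ n (F : (Fin (n+1) → Bool) → Bool), tot F ∈ C → IsMeet F)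
    (hJ : ¬ ∀ n (F : (Fin (n+1) → Bool) → Bool), tot F ∈ C → IsJoin F) :
    Has2 C and ∧ Has2 C or := by
  by_cases hm : ∀ n (F : (Fin (n+1) → Bool) → Bool), tot F ∈ C → MonoF F
  · have hT : ∀ {n : ℕ} (a b : Fin (n+1) → Bool) (F : (Fin (n+1) → Bool) → Bool), tot F ∈ C →
      Has2 C (fun x y => F (fun i => pick (a i) (b i) (fun _ _ => false) (fun _ y => y)
        (fun x _ => x) (fun _ _ => true) x y)) := by
      intro n a b F hF
      exact Has2_of hC hF _ (fun i => pick_prop (P := Has2 C) _ _ (has_c2 c0) has_snd has_fst (has_c2 c1))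
    have e1 : ∀ a b : Bool, pick a b (fun _ _ => false) (fun _ y => y) (fun x _ => x) (fun _ _ => true) false false = (a && b) := by decide
    have e2 : ∀ a b : Bool, pick a b (fun _ _ => false) (fun _ y => y) (fun x _ => x) (fun _ _ => true) false true = b := by decide
    have e3 : ∀ a b : Bool, pick a b (fun _ _ => false) (fun _ y => y) (fun x _ => x) (fun _ _ => true) true false = a := by decide
    have e4 : ∀ a b : Bool, pick a b (fun _ _ => false) (fun _ y => y) (fun x _ => x) (fun _ _ => true) true true = (a || b) := by decide
    constructor
    · obtain ⟨n, F, a, b, hF, h1, h2, h3⟩ := exJoin hJ hm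
      have := hT a b F hF
      refine Has2_congr this ?_ ?_ ?_ ?_
      · simp only [e1]
        by_contra hcon
        have := hm n F hF _ a (fun i hi => by simp at hi; exact hi.1) (by simpa using hcon : F (fun i => a i && b i) = true)
        rw [h1] at this; cases this
      · simp only [e2]; exact h2
      · simp only [e3]; exact h1
      · simp only [e4]; exact h3
    · obtain ⟨n, F, a, b, hF, h1, h2, h3⟩ := exMeet hM hm
      have := hT a b F hF
      refine Has2_congr this ?_ ?_ ?_ ?_
      · simp only [e1]; exact h3
      · simp only [e2]; exact h2
      · simp only [e3]; exact h1
      · simp only [e4]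
        exact hm n F hF a _ (fun i hi => by simp [hi]) h1
  · unfold MonoF at hm
    push Not at hm
    obtain ⟨n, F, hF, a, b, hab, h1, h2⟩ := hm
    have hn : Has1 C not := by
      have h3 := Has1_of hC hF (fun i => pick (a i) (b i) (fun _ => false) (fun x => x) (fun _ => true) (fun _ => true))
        (fun i => pick_prop (P := Has1 C) _ _ (has_c1 c0) has_id (has_c1 c1) (has_c1 c1))
      convert h3 using 1
      have e1 : ∀ a b : Bool, pick a b (fun _ => false) (fun x => x) (fun _ => true) (fun _ => true) false = a := by decide
      have e2 : ∀ a b : Bool, (a = true → b = true) → pick a b (fun _ => false) (fun x => x) (fun _ => true) (fun _ => true) true = b := by decide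
      funext x
      cases x
      · simp only [e1, h1]; rfl
      · simp only [e2 _ _ (hab _)]
        simpa using h2
    push Not at hL
    obtain ⟨n, F, hF, h⟩ := hL
    unfold IsL at h
    push Not at h
    obtain ⟨a, b, c, h⟩ := h
    let T : Bool → Bool → Bool → Bool → Bool → Bool → Bool := fun α β γ x y z =>
      pick (xor α β) (xor α γ) α (xor α y) (xor α x) (xor α z)
    have hT : ∀ α β γ, Has3 C (T α β γ) := by
      intro α β γ
      have hx : Has1 C (fun x => xor α x) := by
        cases α
        · simpa using has_id
        · simpa using hn
      have hcc : Has0 C α := by cases α <;> assumption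
      intro n G H K hG hH hK
      have q1 := hx _ _ hG
      have q2 := hx _ _ hH
      have q3 := hx _ _ hK
      have q0 := hcc n
      simp only [T]
      cases xor α β <;> cases xor α γ <;> assumption
    have hu := Has3_of hC hF (fun i => T (a i) (b i) (c i)) (fun i => hT _ _ _)
    have e0 : ∀ α β γ, T α β γ false false false = α := by decide
    have e1 : ∀ α β γ, T α β γ true false true = β := by decide
    have e2 : ∀ α β γ, T α β γ false true true = γ := by decide
    have e3 : ∀ α β γ, T α β γ true true false = xor (xor α β) γ := by decide
    have g0 : F (fun i => T (a i) (b i) (c i) false false false) = F a := by simp only [e0]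
    have g1 : F (fun i => T (a i) (b i) (c i) true false true) = F b := by simp only [e1]
    have g2 : F (fun i => T (a i) (b i) (c i) false true true) = F c := by simp only [e2]
    have g3 : F (fun i => T (a i) (b i) (c i) true true false) = F (fun i => xor (xor (a i) (b i)) (c i)) := by simp only [e3]
    generalize hU : (fun x y z => F (fun i => T (a i) (b i) (c i) x y z)) = U at hu
    have k0 : U false false false = F a := by rw [← hU]; exact g0
    have k1 : U true false true = F b := by rw [← hU]; exact g1
    have k2 : U false true true = F c := by rw [← hU]; exact g2
    have k3 : U true true false = F (fun i => xor (xor (a i) (b i)) (c i)) := by rw [← hU]; exact g3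
    rw [← k0, ← k1, ← k2, ← k3] at h
    by_cases o1 : xor (xor (U false false false) (U true false false)) (xor (U false true false) (U true true false)) = true
    · exact odd2 hn (u := fun x y => U x y false) (fun n G H hG hH => hu _ _ _ _ hG hH (c0 n)) o1
    by_cases o2 : xor (xor (U false false false) (U true false false)) (xor (U false false true) (U true false true)) = true
    · exact odd2 hn (u := fun x y => U x false y) (fun n G H hG hH => hu _ _ _ _ hG (c0 n) hH) o2
    refine odd2 hn (u := fun x y => U false x y) (fun n G H hG hH => hu _ _ _ _ (c0 n) hG hH) ?_
    revert h o1 o2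
    generalize U false false false = p0
    generalize U false false true = p1
    generalize U false true false = p2
    generalize U false true true = p3
    generalize U true false false = p4
    generalize U true false true = p5
    generalize U true true false = p6
    revert p0 p1 p2 p3 p4 p5 p6
    decide

theorem caseB {C : Set (PF Bool)} (hC : IsClone C) (c0 : Has0 C false) (c1 : ¬ Has0 C true)
    (hT02 : ¬ ∀ n (F : (Fin (n+1) → Bool) → Bool), tot F ∈ C → IsT02 F)
    (hL : ¬ ∀ n (F : (Fin (n+1) → Bool) → Bool), tot F ∈ C → IsL F)
    (hJ : ¬ ∀ n (F : (Fin (n+1) → Bool) → Bool), tot F ∈ C → IsJoin F) :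
    Has2 C and ∧ Has2 C or := by
  have hz : ∀ n (F : (Fin (n+1) → Bool) → Bool), tot F ∈ C → F (fun _ => false) = false := by
    intro n F hF
    by_contra hcon
    apply c1
    intro m
    have := comp_tot hC.1 hF (G := fun _ (_ : Fin (m+1) → Bool) => false) (fun i => c0 m)
    simp only [Bool.not_eq_false] at hcon
    simpa only [hcon] using this
  have hor : Has2 C or ∨ Has2 C xor := by
    push Not at hT02
    obtain ⟨n, F, hF, h⟩ := hT02
    unfold IsT02 at h
    push Not at h
    obtain ⟨a, b, ha, hb, h⟩ := h
    have hu := Has2_of hC hF (fun i => pick (a i) (b i) (fun _ _ => false) (fun _ y => y)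
        (fun x _ => x) (fun _ _ => false)) (fun i => pick_prop (P := Has2 C) _ _ (has_c2 c0) has_snd has_fst (has_c2 c0))
    have e1 : ∀ a b : Bool, pick a b (fun _ _ => false) (fun _ y => y) (fun x _ => x) (fun _ _ => false) false false = false := by decide
    have e2 : ∀ a b : Bool, (a = true → b ≠ true) → pick a b (fun _ _ => false) (fun _ y => y) (fun x _ => x) (fun _ _ => false) false true = b := by decide
    have e3 : ∀ a b : Bool, (a = true → b ≠ true) → pick a b (fun _ _ => false) (fun _ y => y) (fun x _ => x) (fun _ _ => false) true false = a := by decide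
    generalize hU : (fun x y => F (fun i => pick (a i) (b i) (fun _ _ => false) (fun _ y => y)
        (fun x _ => x) (fun _ _ => false) x y)) = U at hu
    have k0 : U false false = false := by rw [← hU]; simp only [e1]; exact hz n F hF
    have k1 : U false true = true := by rw [← hU]; simp only [e2 _ _ (h _)]; exact hb
    have k2 : U true false = true := by rw [← hU]; simp only [e3 _ _ (h _)]; exact ha
    cases k3 : U true true
    · right
      refine Has2_congr hu ?_ ?_ ?_ ?_
      all_goals simp_all
    · left
      refine Has2_congr hu ?_ ?_ ?_ ?_
      all_goals simp_all
  rcases hor with hor | hxor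
  · refine ⟨?_, hor⟩
    by_cases hm : ∀ n (F : (Fin (n+1) → Bool) → Bool), tot F ∈ C → MonoF F
    · obtain ⟨n, F, a, b, hF, h1, h2, h3⟩ := exJoin hJ hm
      have hu := Has2_of hC hF (fun i => pick (a i) (b i) (fun _ _ => false) (fun _ y => y)
        (fun x _ => x) or) (fun i => pick_prop (P := Has2 C) _ _ (has_c2 c0) has_snd has_fst hor)
      have e1 : ∀ a b : Bool, pick a b (fun _ _ => false) (fun _ y => y) (fun x _ => x) or false false = false := by decide
      have e2 : ∀ a b : Bool, pick a b (fun _ _ => false) (fun _ y => y) (fun x _ => x) or false true = b := by decide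
      have e3 : ∀ a b : Bool, pick a b (fun _ _ => false) (fun _ y => y) (fun x _ => x) or true false = a := by decide
      have e4 : ∀ a b : Bool, pick a b (fun _ _ => false) (fun _ y => y) (fun x _ => x) or true true = (a || b) := by decide
      refine Has2_congr hu ?_ ?_ ?_ ?_
      · simp only [e1]; exact hz n F hF
      · simp only [e2]; exact h2
      · simp only [e3]; exact h1
      · simp only [e4]; exact h3
    · unfold MonoF at hm
      push Not at hm
      obtain ⟨n, F, hF, a, b, hab, h1, h2⟩ := hm
      have hu := Has2_of hC hF (fun i => pick (a i) (b i) (fun _ _ => false) (fun _ y => y)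
        (fun x _ => x) or) (fun i => pick_prop (P := Has2 C) _ _ (has_c2 c0) has_snd has_fst hor)
      have e1 : ∀ a b : Bool, pick a b (fun _ _ => false) (fun _ y => y) (fun x _ => x) or false false = false := by decide
      have e3 : ∀ a b : Bool, pick a b (fun _ _ => false) (fun _ y => y) (fun x _ => x) or true false = a := by decide
      have e4 : ∀ a b : Bool, (a = true → b = true) → pick a b (fun _ _ => false) (fun _ y => y) (fun x _ => x) or true true = b := by decide
      have e2 : ∀ a b : Bool, (a = true → b = true) → pick a b (fun _ _ => false) (fun _ y => y) (fun x _ => x) or false true = b := by decide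
      have hand : (fun x y => and x (!y)) = (fun x y => F (fun i => pick (a i) (b i) (fun _ _ => false) (fun _ y => y)
        (fun x _ => x) or x y)) := by
        apply fn2_eq
        · simp only [e1]; exact (hz n F hF).symm
        · simp only [e2 _ _ (hab _)]; simpa using h2
        · simp only [e3]; exact h1.symm
        · simp only [e4 _ _ (hab _)]; simpa using h2
      rw [← hand] at hu
      have : and = fun x y => and x (!(and x (!y))) := by
        funext x y; cases x <;> cases y <;> rfl
      rw [this]
      intro n G H hG hH
      exact hu _ _ _ hG (hu _ _ _ hG hH)
  · have hex : ∃ (n : ℕ) (F : (Fin (n+1) → Bool) → Bool) (a b : Fin (n+1) → Bool), tot F ∈ C ∧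
        F (fun i => xor (a i) (b i)) ≠ xor (F a) (F b) := by
      by_contra hcon
      push Not at hcon
      apply hL
      intro n F hF a b c
      rw [← hcon n F a b hF, ← hcon n F _ c hF]
    obtain ⟨n, F, a, b, hF, h⟩ := hex
    have hu := Has2_of hC hF (fun i => pick (a i) (b i) (fun _ _ => false) (fun _ y => y)
        (fun x _ => x) xor) (fun i => pick_prop (P := Has2 C) _ _ (has_c2 c0) has_snd has_fst hxor)
    have e1 : ∀ a b : Bool, pick a b (fun _ _ => false) (fun _ y => y) (fun x _ => x) xor false false = false := by decide
    have e2 : ∀ a b : Bool, pick a b (fun _ _ => false) (fun _ y => y) (fun x _ => x) xor false true = b := by decide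
    have e3 : ∀ a b : Bool, pick a b (fun _ _ => false) (fun _ y => y) (fun x _ => x) xor true false = a := by decide
    have e4 : ∀ a b : Bool, pick a b (fun _ _ => false) (fun _ y => y) (fun x _ => x) xor true true = xor a b := by decide
    generalize hU : (fun x y => F (fun i => pick (a i) (b i) (fun _ _ => false) (fun _ y => y)
        (fun x _ => x) xor x y)) = U at hu
    have k0 : U false false = false := by rw [← hU]; simp only [e1]; exact hz n F hF
    have k1 : U false true = F b := by rw [← hU]; simp only [e2]
    have k2 : U true false = F a := by rw [← hU]; simp only [e3]
    have k3 : U true true = F (fun i => xor (a i) (b i)) := by rw [← hU]; simp only [e4]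
    rw [← k1, ← k2, ← k3] at h
    have hand : Has2 C and := by
      have hc : ∀ c, Has1 C (fun x => and c x) := by
        intro c
        cases c
        · simpa using has_c1 c0
        · simpa using has_id
      have : and = fun x y => xor (U x y) (xor (and (U true false) x) (and (U false true) y)) := by
        apply fn2_eq <;> (cases h1 : U true false <;> cases h2 : U false true <;> cases h3 : U true true <;> simp_all)
      rw [this]
      intro n G H hG hH
      exact hxor _ _ _ (hu _ _ _ hG hH) (hxor _ _ _ (hc _ _ _ hG) (hc _ _ _ hH))
    refine ⟨hand, ?_⟩
    have : or = fun x y => xor (xor x y) (and x y) := by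
      funext x y; cases x <;> cases y <;> rfl
    rw [this]
    intro n G H hG hH
    exact hxor _ _ _ (hxor _ _ _ hG hH) (hand _ _ _ hG hH)

theorem tot_DD2 {C : Set (PF Bool)} {n : ℕ} {F : (Fin (n+1) → Bool) → Bool} (h : tot F ∈ C) :
    tot (dualT F) ∈ DD C := by
  rw [tot_DD, dualT_dualT]; exact h

theorem Has2_DD {C : Set (PF Bool)} {u : Bool → Bool → Bool} (h : Has2 (DD C) u) :
    Has2 C (fun x y => !u (!x) (!y)) := by
  intro n G H hG hH
  have := (tot_DD _).1 (h n _ _ (tot_DD2 hG) (tot_DD2 hH))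
  convert this using 2
  funext x
  simp [dualT]

theorem caseC {C : Set (PF Bool)} (hC : IsClone C) (c1 : Has0 C true) (c0 : ¬ Has0 C false)
    (hT12 : ¬ ∀ n (F : (Fin (n+1) → Bool) → Bool), tot F ∈ C → IsT12 F)
    (hL : ¬ ∀ n (F : (Fin (n+1) → Bool) → Bool), tot F ∈ C → IsL F)
    (hM : ¬ ∀ n (F : (Fin (n+1) → Bool) → Bool), tot F ∈ C → IsMeet F) :
    Has2 C and ∧ Has2 C or := by
  have := caseB (DD_clone hC) (fun n => by rw [tot_DD]; exact c1 n)
    (fun h => c0 (fun n => by have := h n; rw [tot_DD] at this; exact this))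
    (fun h => hT12 (fun n F hF => by
      rw [← dualT_dualT F]; exact IsT12_dual (h n _ (tot_DD2 hF))))
    (fun h => hL (fun n F hF => by
      rw [← dualT_dualT F]; exact IsL_dual (h n _ (tot_DD2 hF))))
    (fun h => hM (fun n F hF => by
      rw [← dualT_dualT F]; exact IsMeet_dual (h n _ (tot_DD2 hF))))
  refine ⟨Has2_congr (Has2_DD this.2) rfl rfl rfl rfl, Has2_congr (Has2_DD this.1) rfl rfl rfl rfl⟩

theorem Has3_min {C : Set (PF Bool)} (hma : Has3 C maj3) (hd : Has3 C dd3) : Has3 C min3 := by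
  have : min3 = fun x y z => dd3 z (dd3 x y z) (maj3 x y z) := by
    funext x y z; revert x y z; decide
  rw [this]
  intro n G H K hG hH hK
  exact hd _ _ _ _ hK (hd _ _ _ _ hG hH hK) (hma _ _ _ _ hG hH hK)

theorem Has3_maj {C : Set (PF Bool)} (hd : Has3 C dd3) : Has3 C maj3 := by
  have : maj3 = fun x y z => dd3 x y (dd3 x y z) := by
    funext x y z; revert x y z; decide
  rw [this]
  intro n G H K hG hH hK
  exact hd _ _ _ _ hG hH (hd _ _ _ _ hG hH hK)

theorem fn3_eq {u v : Bool → Bool → Bool → Bool}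
    (h : ∀ x y z, u x y z = v x y z) : u = v := by
  funext x y z; exact h x y z

theorem odd3 {C : Set (PF Bool)} (hn : Has1 C not) {u : Bool → Bool → Bool → Bool} (hu : Has3 C u)
    (hs : ∀ x y z, u (!x) (!y) (!z) = !u x y z)
    (ho : xor (xor (u false false false) (u true false false))
      (xor (u false true false) (u true true false)) = true) :
    Has3 C maj3 ∧ Has3 C min3 := by
  have key : ∃ α β γ : Bool, ∀ x y z, maj3 x y z = xor (u (xor x α) (xor y β) z) γ := by
    have up : ∀ x y z, u x y z = xor z (pick (xor x z) (xor y z) (u false false false) (u false true false)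
        (u true false false) (u true true false)) := by
      intro x y z
      have h1 := hs false false false
      have h2 := hs false true false
      have h3 := hs true false false
      have h4 := hs true true false
      simp only [Bool.not_true, Bool.not_false] at h1 h2 h3 h4
      cases x <;> cases y <;> cases z <;> simp [pick, h1, h2, h3, h4]
    have hk : ∀ p q r s : Bool, xor (xor p q) (xor r s) = true →
        ∃ α β γ : Bool, ∀ x y z, maj3 x y z = xor (xor z (pick (xor (xor x α) z) (xor (xor y β) z) p r q s)) γ := by decide
    obtain ⟨α, β, γ, h⟩ := hk _ _ _ _ ho
    refine ⟨α, β, γ, fun x y z => ?_⟩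
    rw [up]; exact h x y z
  obtain ⟨α, β, γ, h⟩ := key
  have hx : ∀ c, Has1 C (fun x => xor x c) := by
    intro c
    cases c
    · simpa using has_id
    · simpa using hn
  have hma : Has3 C maj3 := by
    rw [fn3_eq h]
    intro n G H K hG hH hK
    exact hx γ _ _ (hu _ _ _ _ (hx α _ _ hG) (hx β _ _ hH) hK)
  refine ⟨hma, Has3_min hma ?_⟩
  intro n G H K hG hH hK
  exact hma _ _ _ _ hG hH (hn _ _ hK)

theorem caseD1 {C : Set (PF Bool)} (hC : IsClone C) (c1 : ¬ Has0 C true) (c0 : ¬ Has0 C false)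
    (hn : Has1 C not)
    (hL : ¬ ∀ n (F : (Fin (n+1) → Bool) → Bool), tot F ∈ C → IsL F) :
    Has3 C maj3 ∧ Has3 C min3 := by
  have hx : ∀ c, Has1 C (fun x => xor c x) := by
    intro c
    cases c
    · simpa using has_id
    · simpa using hn
  have hs : ∀ n (F : (Fin (n+1) → Bool) → Bool), tot F ∈ C → ∀ a, F (fun i => !a i) = !F a := by
    intro n F hF a
    by_contra hcon
    have hcon : F (fun i => !a i) = F a := by
      revert hcon; cases F (fun i => !a i) <;> cases F a <;> simp
    have h1 := Has1_of hC hF (fun i x => xor (a i) x) (fun i => hx (a i))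
    have h2 : (fun x => F (fun i => xor (a i) x)) = fun _ => F a := by
      funext x
      cases x
      · simp
      · simpa using hcon
    rw [h2] at h1
    have h3 := Has0_of hC h1
    cases h : F a <;> rw [h] at h3
    · exact c0 h3
    · exact c1 h3
  push Not at hL
  obtain ⟨n, F, hF, h⟩ := hL
  unfold IsL at h
  push Not at h
  obtain ⟨a, b, c, h⟩ := h
  let T : Bool → Bool → Bool → Bool → Bool → Bool → Bool → Bool := fun α β γ x y z w =>
    pick (xor α β) (xor α γ) (xor α w) (xor α y) (xor α x) (xor α z)
  have hT : ∀ α β γ, Has4 C (T α β γ) := by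
    intro α β γ
    intro n G H K L hG hH hK hL
    have q1 := hx α _ _ hG
    have q2 := hx α _ _ hH
    have q3 := hx α _ _ hK
    have q4 := hx α _ _ hL
    simp only [T]
    cases xor α β <;> cases xor α γ <;> assumption
  have hu := Has4_of hC hF (fun i => T (a i) (b i) (c i)) (fun i => hT _ _ _)
  have e0 : ∀ α β γ, T α β γ false false false false = α := by decide
  have e1 : ∀ α β γ, T α β γ true false true false = β := by decide
  have e2 : ∀ α β γ, T α β γ false true true false = γ := by decide
  have e3 : ∀ α β γ, T α β γ true true false false = xor (xor α β) γ := by decide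
  have e4 : ∀ α β γ x y z w, T α β γ (!x) (!y) (!z) (!w) = !T α β γ x y z w := by decide
  have g0 : F (fun i => T (a i) (b i) (c i) false false false false) = F a := by simp only [e0]
  have g1 : F (fun i => T (a i) (b i) (c i) true false true false) = F b := by simp only [e1]
  have g2 : F (fun i => T (a i) (b i) (c i) false true true false) = F c := by simp only [e2]
  have g3 : F (fun i => T (a i) (b i) (c i) true true false false) = F (fun i => xor (xor (a i) (b i)) (c i)) := by simp only [e3]
  have g4 : ∀ x y z w, F (fun i => T (a i) (b i) (c i) (!x) (!y) (!z) (!w)) = !F (fun i => T (a i) (b i) (c i) x y z w) := by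
    intro x y z w
    simp only [e4]
    exact hs n F hF _
  generalize hU : (fun x y z w => F (fun i => T (a i) (b i) (c i) x y z w)) = U at hu
  have k0 : U false false false false = F a := by rw [← hU]; exact g0
  have k1 : U true false true false = F b := by rw [← hU]; exact g1
  have k2 : U false true true false = F c := by rw [← hU]; exact g2
  have k3 : U true true false false = F (fun i => xor (xor (a i) (b i)) (c i)) := by rw [← hU]; exact g3
  have k4 : ∀ x y z w, U (!x) (!y) (!z) (!w) = !U x y z w := by rw [← hU]; exact g4
  rw [← k0, ← k1, ← k2, ← k3] at h
  by_cases o1 : xor (xor (U false false false false) (U true false false false)) (xor (U false true false false) (U true true false false)) = true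
  · exact odd3 hn (u := fun x y z => U x y z z) (fun n G H K hG hH hK => hu _ _ _ _ _ hG hH hK hK) (fun x y z => k4 _ _ _ _) o1
  by_cases o2 : xor (xor (U false false false false) (U true false false false)) (xor (U false false true false) (U true false true false)) = true
  · exact odd3 hn (u := fun x y z => U x z y z) (fun n G H K hG hH hK => hu _ _ _ _ _ hG hK hH hK) (fun x y z => k4 _ _ _ _) o2
  refine odd3 hn (u := fun x y z => U z x y z) (fun n G H K hG hH hK => hu _ _ _ _ _ hK hG hH hK) (fun x y z => k4 _ _ _ _) ?_
  revert h o1 o2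
  generalize U false false false false = p0
  generalize U false false true false = p1
  generalize U false true false false = p2
  generalize U false true true false = p3
  generalize U true false false false = p4
  generalize U true false true false = p5
  generalize U true true false false = p6
  revert p0 p1 p2 p3 p4 p5 p6
  decide

/-- self-dual idempotent ternary functions in terms of three values -/
theorem sd3 {u : Bool → Bool → Bool → Bool} (hs : ∀ x y z, u (!x) (!y) (!z) = !u x y z)
    (h0 : u false false false = false) (x y z : Bool) : u x y z = xor x (pick (xor x y) (xor x z)
      false (u false false true) (u false true false) (!u true false false)) := by
  have h1 := hs false false false
  have h2 := hs false true false
  have h3 := hs true false false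
  have h4 := hs false false true
  simp only [Bool.not_true, Bool.not_false] at h1 h2 h3 h4
  cases x <;> cases y <;> cases z <;> simp [pick, h0, h1, h2, h3, h4]

theorem even3 {C : Set (PF Bool)} {u : Bool → Bool → Bool → Bool} (hu : Has3 C u)
    (hs : ∀ x y z, u (!x) (!y) (!z) = !u x y z)
    (h0 : u false false false = false)
    (ho : xor (xor (u true false false) (u false true false)) (u false false true) = false) :
    Has3 C maj3 := by
  have up := sd3 hs h0
  have hk : ∀ p q r : Bool, xor (xor p q) r = false →
      (∀ x y z, maj3 x y z = xor x (pick (xor x y) (xor x z) false r q (!p))) ∨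
      (∀ x y z, dd3 x y z = xor x (pick (xor x y) (xor x z) false r q (!p))) ∨
      (∀ x y z, dd3 x z y = xor x (pick (xor x y) (xor x z) false r q (!p))) ∨
      (∀ x y z, dd3 y z x = xor x (pick (xor x y) (xor x z) false r q (!p))) := by decide
  rcases hk _ _ _ ho with h | h | h | h
  · rw [fn3_eq (fun x y z => (h x y z).trans (up x y z).symm)]; exact hu
  · apply Has3_maj
    rw [fn3_eq (fun x y z => (h x y z).trans (up x y z).symm)]; exact hu
  · apply Has3_maj
    rw [fn3_eq (v := fun x y z => u x z y) (fun x y z => (h x z y).trans (up x z y).symm)]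
    intro n G H K hG hH hK
    exact hu _ _ _ _ hG hK hH
  · apply Has3_maj
    rw [fn3_eq (v := fun x y z => u z x y) (fun x y z => (h z x y).trans (up z x y).symm)]
    intro n G H K hG hH hK
    exact hu _ _ _ _ hK hG hH

theorem caseD2 {C : Set (PF Bool)} (hC : IsClone C)
    (hz : ∀ n (F : (Fin (n+1) → Bool) → Bool), tot F ∈ C → F (fun _ => false) = false)
    (ho : ∀ n (F : (Fin (n+1) → Bool) → Bool), tot F ∈ C → F (fun _ => true) = true)
    (hT02 : ¬ ∀ n (F : (Fin (n+1) → Bool) → Bool), tot F ∈ C → IsT02 F)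
    (hT12 : ¬ ∀ n (F : (Fin (n+1) → Bool) → Bool), tot F ∈ C → IsT12 F)
    (hL : ¬ ∀ n (F : (Fin (n+1) → Bool) → Bool), tot F ∈ C → IsL F) :
    (Has2 C and ∧ Has2 C or) ∨ (Has3 C maj3 ∧ Has3 C min3) := by
  push Not at hT02 hT12
  obtain ⟨n0, F0, hF0, h0⟩ := hT02
  unfold IsT02 at h0
  push Not at h0
  obtain ⟨a0, b0, ha0, hb0, h0⟩ := h0
  by_cases hs : ∀ n (F : (Fin (n+1) → Bool) → Bool), tot F ∈ C → ∀ a, F (fun i => !a i) = !F a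
  swap
  · left
    push Not at hs
    obtain ⟨n, F, hF, a, ha⟩ := hs
    have hu := Has2_of hC hF (fun i x y => if a i then x else y) (fun i => by
      cases a i
      · exact has_snd
      · exact has_fst)
    generalize hU : (fun x y => F (fun i => if a i then x else y)) = U at hu
    have k0 : U false false = false := by rw [← hU]; simpa using hz n F hF
    have k1 : U true true = true := by rw [← hU]; simpa using ho n F hF
    have k2 : U true false = F a := by rw [← hU]; simp
    have k3 : U false true = F (fun i => !a i) := by
      rw [← hU]
      show F _ = F _
      congr 1
      funext i
      cases a i <;> rfl
    cases hFa : F a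
    · have hand : Has2 C and := Has2_congr hu k0 (by simp_all) (by simp_all) k1
      refine ⟨hand, ?_⟩
      have hu := Has2_of hC hF0 (fun i => pick (a0 i) (b0 i) and (fun _ y => y)
        (fun x _ => x) and) (fun i => pick_prop (P := Has2 C) _ _ hand has_snd has_fst hand)
      have e1 : ∀ a b : Bool, pick a b and (fun _ y => y) (fun x _ => x) and false false = false := by decide
      have e2 : ∀ a b : Bool, (a = true → b ≠ true) → pick a b and (fun _ y => y) (fun x _ => x) and false true = b := by decide
      have e3 : ∀ a b : Bool, (a = true → b ≠ true) → pick a b and (fun _ y => y) (fun x _ => x) and true false = a := by decide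
      have e4 : ∀ a b : Bool, pick a b and (fun _ y => y) (fun x _ => x) and true true = true := by decide
      refine Has2_congr hu ?_ ?_ ?_ ?_
      · simp only [e1]; exact hz _ _ hF0
      · simp only [e2 _ _ (h0 _)]; exact hb0
      · simp only [e3 _ _ (h0 _)]; exact ha0
      · simp only [e4]; exact ho _ _ hF0
    · have hor : Has2 C or := Has2_congr hu k0 (by simp_all) (by simp_all) k1
      refine ⟨?_, hor⟩
      obtain ⟨n1, F1, hF1, h1⟩ := hT12
      unfold IsT12 at h1
      push Not at h1
      obtain ⟨a1, b1, ha1, hb1, h1⟩ := h1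
      have hu := Has2_of hC hF1 (fun i => pick (a1 i) (b1 i) or (fun _ y => y)
        (fun x _ => x) or) (fun i => pick_prop (P := Has2 C) _ _ hor has_snd has_fst hor)
      have e1 : ∀ a b : Bool, pick a b or (fun _ y => y) (fun x _ => x) or false false = false := by decide
      have e2 : ∀ a b : Bool, (a = false → b ≠ false) → pick a b or (fun _ y => y) (fun x _ => x) or false true = b := by decide
      have e3 : ∀ a b : Bool, (a = false → b ≠ false) → pick a b or (fun _ y => y) (fun x _ => x) or true false = a := by decide
      have e4 : ∀ a b : Bool, pick a b or (fun _ y => y) (fun x _ => x) or true true = true := by decide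
      refine Has2_congr hu ?_ ?_ ?_ ?_
      · simp only [e1]; exact hz _ _ hF1
      · simp only [e2 _ _ (h1 _)]; exact hb1
      · simp only [e3 _ _ (h1 _)]; exact ha1
      · simp only [e4]; exact ho _ _ hF1
  · right
    -- self-dual case
    have hdm : Has3 C min3 ∨ Has3 C dd3 := by
      have hu := Has3_of hC hF0 (fun i => pick (a0 i) (b0 i) (fun _ _ z => z) (fun _ y _ => y)
        (fun x _ _ => x) (fun _ _ z => z)) (fun i => pick_prop (P := Has3 C) _ _
          (fun _ _ _ _ _ _ h => h) (fun _ _ _ _ _ h _ => h) (fun _ _ _ _ h _ _ => h) (fun _ _ _ _ _ _ h => h))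
      have e1 : ∀ a b : Bool, pick a b (fun _ _ z => z) (fun _ y _ => y) (fun x _ _ => x) (fun _ _ z => z) false false false = false := by decide
      have e2 : ∀ a b : Bool, (a = true → b ≠ true) → pick a b (fun _ _ z => z) (fun _ y _ => y) (fun x _ _ => x) (fun _ _ z => z) false true false = b := by decide
      have e3 : ∀ a b : Bool, (a = true → b ≠ true) → pick a b (fun _ _ z => z) (fun _ y _ => y) (fun x _ _ => x) (fun _ _ z => z) true false false = a := by decide
      have e4 : ∀ a b x y z : Bool, pick a b (fun _ _ z => z) (fun _ y _ => y) (fun x _ _ => x) (fun _ _ z => z) (!x) (!y) (!z) = !pick a b (fun _ _ z => z) (fun _ y _ => y) (fun x _ _ => x) (fun _ _ z => z) x y z := by decide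
      generalize hU : (fun x y z => F0 (fun i => pick (a0 i) (b0 i) (fun _ _ z => z) (fun _ y _ => y)
        (fun x _ _ => x) (fun _ _ z => z) x y z)) = U at hu
      have k0 : U false false false = false := by rw [← hU]; simp only [e1]; exact hz _ _ hF0
      have k1 : U false true false = true := by rw [← hU]; simp only [e2 _ _ (h0 _)]; exact hb0
      have k2 : U true false false = true := by rw [← hU]; simp only [e3 _ _ (h0 _)]; exact ha0
      have k4 : ∀ x y z, U (!x) (!y) (!z) = !U x y z := by
        rw [← hU]
        intro x y z
        simp only [e4]
        exact hs _ _ hF0 _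
      have up := sd3 k4 k0
      rw [k1, k2] at up
      cases h1 : U false false true
      · right
        rw [h1] at up
        have : dd3 = U := fn3_eq (fun x y z => by
          rw [up]; revert x y z; decide)
        rw [this]; exact hu
      · left
        rw [h1] at up
        have : min3 = U := fn3_eq (fun x y z => by
          rw [up]; revert x y z; decide)
        rw [this]; exact hu
    rcases hdm with hmi | hd
    swap
    · exact ⟨Has3_maj hd, Has3_min (Has3_maj hd) hd⟩
    refine ⟨?_, hmi⟩
    push Not at hL
    obtain ⟨n, F, hF, h⟩ := hL
    unfold IsL at h
    push Not at h
    obtain ⟨a, b, c, h⟩ := h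
    let T : Bool → Bool → Bool → Bool → Bool → Bool → Bool → Bool := fun α β γ x y z w =>
      xor (xor (α && x) (β && y)) (xor (γ && z) ((!(xor (xor α β) γ)) && w))
    have hT : ∀ α β γ, Has4 C (T α β γ) := by
      intro α β γ
      intro n G H K L hG hH hK hL
      have q1 := hmi _ _ _ _ hG hH hK
      have q2 := hmi _ _ _ _ hG hH hL
      have q3 := hmi _ _ _ _ hG hK hL
      have q4 := hmi _ _ _ _ hH hK hL
      cases α <;> cases β <;> cases γ <;> simp [T] <;> first | assumption | (simpa [min3] using q1) | (simpa [min3] using q2) | (simpa [min3] using q3) | (simpa [min3] using q4)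
    have hu := Has4_of hC hF (fun i => T (a i) (b i) (c i)) (fun i => hT _ _ _)
    have e0 : ∀ α β γ, T α β γ true false false false = α := by decide
    have e1 : ∀ α β γ, T α β γ false true false false = β := by decide
    have e2 : ∀ α β γ, T α β γ false false true false = γ := by decide
    have e3 : ∀ α β γ, T α β γ true true true false = xor (xor α β) γ := by decide
    have e4 : ∀ α β γ x y z w, T α β γ (!x) (!y) (!z) (!w) = !T α β γ x y z w := by decide
    have e5 : ∀ α β γ, T α β γ false false false false = false := by decide
    have g0 : F (fun i => T (a i) (b i) (c i) true false false false) = F a := by simp only [e0]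
    have g1 : F (fun i => T (a i) (b i) (c i) false true false false) = F b := by simp only [e1]
    have g2 : F (fun i => T (a i) (b i) (c i) false false true false) = F c := by simp only [e2]
    have g3 : F (fun i => T (a i) (b i) (c i) true true true false) = F (fun i => xor (xor (a i) (b i)) (c i)) := by simp only [e3]
    have g4 : ∀ x y z w, F (fun i => T (a i) (b i) (c i) (!x) (!y) (!z) (!w)) = !F (fun i => T (a i) (b i) (c i) x y z w) := by
      intro x y z w
      simp only [e4]
      exact hs n F hF _
    have g5 : F (fun i => T (a i) (b i) (c i) false false false false) = false := by
      simp only [e5]; exact hz n F hF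
    generalize hU : (fun x y z w => F (fun i => T (a i) (b i) (c i) x y z w)) = U at hu
    have k0 : U true false false false = F a := by rw [← hU]; exact g0
    have k1 : U false true false false = F b := by rw [← hU]; exact g1
    have k2 : U false false true false = F c := by rw [← hU]; exact g2
    have k3 : U true true true false = F (fun i => xor (xor (a i) (b i)) (c i)) := by rw [← hU]; exact g3
    have k4 : ∀ x y z w, U (!x) (!y) (!z) (!w) = !U x y z w := by rw [← hU]; exact g4
    have k5 : U false false false false = false := by rw [← hU]; exact g5
    rw [← k0, ← k1, ← k2, ← k3] at h
    by_cases o1 : xor (xor (U true false false false) (U false true false false)) (U false false true true) = false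
    · exact even3 (u := fun x y z => U x y z z) (fun n G H K hG hH hK => hu _ _ _ _ _ hG hH hK hK) (fun x y z => k4 _ _ _ _) k5 o1
    refine even3 (u := fun x y z => U x x y z) (fun n G H K hG hH hK => hu _ _ _ _ _ hG hG hH hK) (fun x y z => k4 _ _ _ _) k5 ?_
    have l1 := k4 true true false false
    have l2 := k4 true true true false
    simp only [Bool.not_true, Bool.not_false] at l1 l2
    rw [l1] at o1
    show xor (xor (U true true false false) (U false false true false)) (U false false false true) = false
    rw [l2]
    revert h o1
    generalize U true false false false = p0
    generalize U false true false false = p1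
    generalize U false false true false = p2
    generalize U true true true false = p3
    generalize U true true false false = p4
    revert p0 p1 p2 p3 p4
    decide

theorem post_case {C : Set (PF Bool)} (hC : IsClone C)
    (hT02 : ¬ ∀ n (F : (Fin (n+1) → Bool) → Bool), tot F ∈ C → IsT02 F)
    (hT12 : ¬ ∀ n (F : (Fin (n+1) → Bool) → Bool), tot F ∈ C → IsT12 F)
    (hL : ¬ ∀ n (F : (Fin (n+1) → Bool) → Bool), tot F ∈ C → IsL F)
    (hM : ¬ ∀ n (F : (Fin (n+1) → Bool) → Bool), tot F ∈ C → IsMeet F)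
    (hJ : ¬ ∀ n (F : (Fin (n+1) → Bool) → Bool), tot F ∈ C → IsJoin F) :
    (Has2 C and ∧ Has2 C or) ∨ (Has3 C maj3 ∧ Has3 C min3) := by
  by_cases c0 : Has0 C false
  · left
    by_cases c1 : Has0 C true
    · exact caseA hC c0 c1 hL hM hJ
    · exact caseB hC c0 c1 hT02 hL hJ
  by_cases c1 : Has0 C true
  · left
    exact caseC hC c1 c0 hT12 hL hM
  by_cases hn : Has1 C not
  · right
    exact caseD1 hC c1 c0 hn hL
  have key : ∀ n (F : (Fin (n+1) → Bool) → Bool), tot F ∈ C →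
      F (fun _ => false) = false ∧ F (fun _ => true) = true := by
    intro n F hF
    have hu := Has1_of hC hF (fun i x => x) (fun i => has_id)
    rw [fn1_eq (fun x => F (fun _ => x))] at hu
    cases h0 : F (fun _ => false) <;> cases h1 : F (fun _ => true)
    · exfalso
      simp only [h0, h1] at hu
      exact c0 (Has0_of hC (by simpa using hu))
    · exact ⟨rfl, rfl⟩
    · exfalso
      simp only [h0, h1] at hu
      exact hn (by simpa using hu)
    · exfalso
      simp only [h0, h1] at hu
      exact c1 (Has0_of hC (by simpa using hu))
  exact caseD2 hC (fun n F hF => (key n F hF).1) (fun n F hF => (key n F hF).2) hT02 hT12 hL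

def CC {V : Type} (ρ : Set (V → Bool)) (k : V) : Prop := ∃ c, ∀ x ∈ ρ, x k = c

theorem nCC {V : Type} {ρ : Set (V → Bool)} {k : V} (h : ¬ CC ρ k) (c : Bool) : ∃ x ∈ ρ, x k = c := by
  by_contra hh
  apply h
  refine ⟨!c, fun x hx => ?_⟩
  by_contra h3
  apply hh
  refine ⟨x, hx, ?_⟩
  cases c <;> cases h4 : x k <;> simp_all

def Red {V : Type} (ρ : Set (V → Bool)) (t : V → Bool) : Prop :=
  ∃ (φ : V → Fin 4) (ψ : Fin 4 → V), (∀ x ∈ ρ, (fun k => x (ψ (φ k))) ∈ ρ) ∧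
    (fun k => t (ψ (φ k))) ∉ ρ

theorem red_of {V : Type} {ρ : Set (V → Bool)} {t : V → Bool}
    (hsep : ∀ v w : V, (∀ x ∈ ρ, x v = x w) → v = w) (e : V → V) (i j : V)
    (he : ∀ k, e k = i ∨ e k = j ∨ (e k = k ∧ CC ρ k))
    (h1 : ∀ x ∈ ρ, (fun k => x (e k)) ∈ ρ) (h2 : (fun k => t (e k)) ∉ ρ) : Red ρ t := by
  have hcc : ∀ c : Bool, ∃ a : V, ∀ k, (∀ x ∈ ρ, x k = c) → k = a := by
    intro c
    by_cases h : ∃ a : V, ∀ x ∈ ρ, x a = c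
    · obtain ⟨a, ha⟩ := h
      exact ⟨a, fun k hk => hsep _ _ fun x hx => (hk x hx).trans (ha x hx).symm⟩
    · exact ⟨i, fun k hk => absurd ⟨k, hk⟩ h⟩
  obtain ⟨a, ha⟩ := hcc false
  obtain ⟨b, hb⟩ := hcc true
  have : ∀ k, ∃ m : Fin 4, (![i, j, a, b] : Fin 4 → V) m = e k := by
    intro k
    rcases he k with h | h | ⟨h, c, hc⟩
    · exact ⟨0, h.symm⟩
    · exact ⟨1, h.symm⟩
    · cases c
      · exact ⟨2, by rw [h]; exact (ha k hc).symm⟩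
      · exact ⟨3, by rw [h]; exact (hb k hc).symm⟩
  choose φ hφ using this
  refine ⟨φ, ![i, j, a, b], ?_, ?_⟩
  · intro x hx
    simpa only [hφ] using h1 x hx
  · simpa only [hφ] using h2

/-- constant violation with good pairs -/
theorem red_const {V : Type} [Finite V] {ρ : Set (V → Bool)} {t : V → Bool}
    (hmaj : ∀ x ∈ ρ, ∀ y ∈ ρ, ∀ z ∈ ρ, (fun i => maj3 (x i) (y i) (z i)) ∈ ρ)
    (hsep : ∀ v w : V, (∀ x ∈ ρ, x v = x w) → v = w) (i : V) (c : Bool)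
    (hi : ∀ x ∈ ρ, x i = c) (ht : t i ≠ c)
    (hp : ∀ k l, ¬ CC ρ k → ¬ CC ρ l → ∃ w ∈ ρ, w k = c ∧ w l = c) : Red ρ t := by
  classical
  refine red_of hsep (fun k => if CC ρ k then k else i) i i ?_ ?_ ?_
  · intro k
    by_cases h : CC ρ k
    · exact Or.inr (Or.inr ⟨by simp [h], h⟩)
    · exact Or.inl (by simp [h])
  · intro x hx
    refine baker_pixley ⟨x, hx⟩ hmaj _ ?_
    intro k l
    by_cases hk : CC ρ k <;> by_cases hl : CC ρ l
    · exact ⟨x, hx, by simp [hk], by simp [hl]⟩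
    · obtain ⟨d, hd⟩ := id hk
      obtain ⟨w, hw, hw2⟩ := nCC hl c
      exact ⟨w, hw, by simp only [hk, if_true]; rw [hd _ hw, hd _ hx], by simp [hl, hw2, hi x hx]⟩
    · obtain ⟨d, hd⟩ := id hl
      obtain ⟨w, hw, hw2⟩ := nCC hk c
      exact ⟨w, hw, by simp [hk, hw2, hi x hx], by simp only [hl, if_true]; rw [hd _ hw, hd _ hx]⟩
    · obtain ⟨w, hw, h1, h2⟩ := hp k l hk hl
      exact ⟨w, hw, by simp [hk, h1, hi x hx], by simp [hl, h2, hi x hx]⟩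
  · intro h
    have := hi _ h
    have h2 : CC ρ i := ⟨c, hi⟩
    simp only [h2, if_true] at this
    exact ht this

theorem pair_M {V : Type} {ρ : Set (V → Bool)}
    (hand : ∀ x ∈ ρ, ∀ y ∈ ρ, (fun i => x i && y i) ∈ ρ)
    (hor : ∀ x ∈ ρ, ∀ y ∈ ρ, (fun i => x i || y i) ∈ ρ) (c : Bool) (k l : V)
    (hk : ∃ x ∈ ρ, x k = c) (hl : ∃ x ∈ ρ, x l = c) : ∃ w ∈ ρ, w k = c ∧ w l = c := by
  obtain ⟨x, hx, h1⟩ := hk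
  obtain ⟨y, hy, h2⟩ := hl
  cases c
  · exact ⟨_, hand x hx y hy, by simp [h1], by simp [h2]⟩
  · exact ⟨_, hor x hx y hy, by simp [h1], by simp [h2]⟩

theorem red_M2 {V : Type} [Finite V] {ρ : Set (V → Bool)} {t : V → Bool}
    (hmaj : ∀ x ∈ ρ, ∀ y ∈ ρ, ∀ z ∈ ρ, (fun i => maj3 (x i) (y i) (z i)) ∈ ρ)
    (hand : ∀ x ∈ ρ, ∀ y ∈ ρ, (fun i => x i && y i) ∈ ρ)
    (hor : ∀ x ∈ ρ, ∀ y ∈ ρ, (fun i => x i || y i) ∈ ρ)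
    (hsep : ∀ v w : V, (∀ x ∈ ρ, x v = x w) → v = w) (i j : V)
    (hi : ¬ CC ρ i) (hj : ¬ CC ρ j) (hti : t i = true) (htj : t j = false)
    (hij : ∀ x ∈ ρ, x i = true → x j = true) : Red ρ t := by
  classical
  have hji : ¬ ∀ x ∈ ρ, x j = true → x i = true := by
    intro h
    have : i = j := hsep _ _ fun x hx => by
      have h1 := hij x hx
      have h2 := h x hx
      cases h3 : x i <;> cases h4 : x j <;> simp_all
    rw [this, htj] at hti
    cases hti
  refine red_of hsep (fun k => if CC ρ k then k else if (∀ x ∈ ρ, x k = true → x i = true) then i else j) i j ?_ ?_ ?_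
  · intro k
    by_cases h : CC ρ k
    · exact Or.inr (Or.inr ⟨by simp [h], h⟩)
    · by_cases h2 : (∀ x ∈ ρ, x k = true → x i = true)
      · exact Or.inl (by simp only [h, if_false]; rw [if_pos h2])
      · exact Or.inr (Or.inl (by simp only [h, if_false]; rw [if_neg h2]))
  · intro x hx
    refine baker_pixley ⟨x, hx⟩ hmaj _ ?_
    intro k l
    by_cases hk : CC ρ k <;> by_cases hl : CC ρ l
    · exact ⟨x, hx, by simp [hk], by simp [hl]⟩
    · obtain ⟨d, hd⟩ := id hk
      obtain ⟨w, hw, hw2⟩ := nCC hl (x (if (∀ x ∈ ρ, x l = true → x i = true) then i else j))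
      exact ⟨w, hw, by simp only [hk, if_true]; rw [hd _ hw, hd _ hx], by simp only [hl, if_false]; exact hw2⟩
    · obtain ⟨d, hd⟩ := id hl
      obtain ⟨w, hw, hw2⟩ := nCC hk (x (if (∀ x ∈ ρ, x k = true → x i = true) then i else j))
      exact ⟨w, hw, by simp only [hk, if_false]; exact hw2, by simp only [hl, if_true]; rw [hd _ hw, hd _ hx]⟩
    · simp only [hk, hl, if_false]
      have key : ∀ c, ∃ w ∈ ρ, w k = c ∧ w l = c := fun c =>
        pair_M hand hor c k l (nCC hk c) (nCC hl c)
      by_cases hxx : x i = x j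
      · obtain ⟨w, hw, h1, h2⟩ := key (x i)
        refine ⟨w, hw, ?_, ?_⟩
        · split_ifs <;> simp [h1, hxx]
        · split_ifs <;> simp [h2, hxx]
      · have hxi : x i = false := by
          cases h : x i
          · rfl
          · exact absurd (h.trans (hij x hx h).symm) hxx
        have hxj : x j = true := by
          cases h : x j
          · exact absurd (hxi.trans h.symm) hxx
          · rfl
        by_cases h1 : (∀ x ∈ ρ, x k = true → x i = true) <;>
          by_cases h2 : (∀ x ∈ ρ, x l = true → x i = true)
        · rw [if_pos h1, if_pos h2, hxi]; exact key false
        · rw [if_pos h1, if_neg h2, hxi, hxj]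
          push Not at h2
          obtain ⟨y, hy, h3, h4⟩ := h2
          refine ⟨y, hy, ?_, h3⟩
          cases h5 : y k
          · rfl
          · exact absurd (h1 y hy h5) h4
        · rw [if_neg h1, if_pos h2, hxi, hxj]
          push Not at h1
          obtain ⟨y, hy, h3, h4⟩ := h1
          refine ⟨y, hy, h3, ?_⟩
          cases h5 : y l
          · rfl
          · exact absurd (h2 y hy h5) h4
        · rw [if_neg h1, if_neg h2, hxj]; exact key true
  · intro h
    have := hij _ h
    simp only [hi, hj, if_false] at this
    rw [if_pos (fun _ _ h => h), if_neg hji] at this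
    rw [this hti] at htj
    cases htj

theorem not_eq_iff_eq_not' {a b : Bool} (h : a ≠ b) : a = !b := by
  cases a <;> cases b <;> simp_all

theorem red_M {V : Type} [Finite V] {ρ : Set (V → Bool)} {t : V → Bool} (hne : ρ.Nonempty)
    (hand : ∀ x ∈ ρ, ∀ y ∈ ρ, (fun i => x i && y i) ∈ ρ)
    (hor : ∀ x ∈ ρ, ∀ y ∈ ρ, (fun i => x i || y i) ∈ ρ)
    (hsep : ∀ v w : V, (∀ x ∈ ρ, x v = x w) → v = w) (ht : t ∉ ρ) : Red ρ t := by
  have hmaj : ∀ x ∈ ρ, ∀ y ∈ ρ, ∀ z ∈ ρ, (fun i => maj3 (x i) (y i) (z i)) ∈ ρ := fun x hx y hy z hz =>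
    hor _ (hor _ (hand _ hx _ hy) _ (hand _ hx _ hz)) _ (hand _ hy _ hz)
  by_cases hc : ∃ i, ∀ x ∈ ρ, x i ≠ t i
  · obtain ⟨i, hi⟩ := hc
    exact red_const hmaj hsep i (!t i) (fun x hx => not_eq_iff_eq_not' (hi x hx)) (by simp)
      (fun k l hk hl => pair_M hand hor _ k l (nCC hk _) (nCC hl _))
  · push Not at hc
    have hb : ¬ ∀ i j, ∃ x ∈ ρ, x i = t i ∧ x j = t j := fun h => ht (baker_pixley hne hmaj t h)
    push Not at hb
    obtain ⟨i, j, hij⟩ := hb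
    obtain ⟨u, hu, hui⟩ := hc i
    obtain ⟨v, hv, hvj⟩ := hc j
    have huj := hij u hu hui
    have hvi : v i ≠ t i := fun h => hij v hv h hvj
    have hi : ¬ CC ρ i := by
      rintro ⟨c, h⟩
      exact hvi ((h v hv).trans ((h u hu).symm.trans hui))
    have hj : ¬ CC ρ j := by
      rintro ⟨c, h⟩
      exact huj ((h u hu).trans ((h v hv).symm.trans hvj))
    have ha := hij _ (hand u hu v hv)
    have ho := hij _ (hor u hu v hv)
    cases h1 : t i <;> cases h2 : t j
    · exact (ha (by simp [hui, h1]) (by simp [hvj, h2])).elim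
    · refine red_M2 hmaj hand hor hsep j i hj hi h2 h1 ?_
      intro x hx h
      have := hij x hx
      cases h3 : x i
      · exact (this (h3.trans h1.symm) (h.trans h2.symm)).elim
      · rfl
    · refine red_M2 hmaj hand hor hsep i j hi hj h1 h2 ?_
      intro x hx h
      have := hij x hx
      cases h3 : x j
      · exact (this (h.trans h1.symm) (h3.trans h2.symm)).elim
      · rfl
    · exact (ho (by simp [hui, h1]) (by simp [hvj, h2])).elim

theorem flip_S {V : Type} [Finite V] {ρ : Set (V → Bool)}
    (hmaj : ∀ x ∈ ρ, ∀ y ∈ ρ, ∀ z ∈ ρ, (fun i => maj3 (x i) (y i) (z i)) ∈ ρ)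
    (hmin : ∀ x ∈ ρ, ∀ y ∈ ρ, ∀ z ∈ ρ, (fun i => min3 (x i) (y i) (z i)) ∈ ρ)
    (y : V → Bool) (x0 : V → Bool) (hx0 : x0 ∈ ρ) (h1 : ∀ k, CC ρ k → y k = x0 k)
    (h2 : ∀ k, ¬ CC ρ k → y k = !x0 k) : y ∈ ρ := by
  refine baker_pixley ⟨_, hx0⟩ hmaj _ ?_
  intro k l
  by_cases hk : CC ρ k <;> by_cases hl : CC ρ l
  · exact ⟨x0, hx0, (h1 k hk).symm, (h1 l hl).symm⟩
  · obtain ⟨w, hw, hw2⟩ := nCC hl (y l)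
    refine ⟨w, hw, ?_, hw2⟩
    rw [h1 k hk]
    obtain ⟨c, hc⟩ := hk
    rw [hc _ hw, hc _ hx0]
  · obtain ⟨w, hw, hw2⟩ := nCC hk (y k)
    refine ⟨w, hw, hw2, ?_⟩
    rw [h1 l hl]
    obtain ⟨c, hc⟩ := hl
    rw [hc _ hw, hc _ hx0]
  · obtain ⟨u, hu, hu2⟩ := nCC hk (y k)
    obtain ⟨v, hv, hv2⟩ := nCC hl (y l)
    by_cases h3 : u l = y l
    · exact ⟨u, hu, hu2, h3⟩
    by_cases h4 : v k = y k
    · exact ⟨v, hv, h4, hv2⟩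
    refine ⟨_, hmin u hu v hv x0 hx0, ?_, ?_⟩
    · have := h2 k hk
      have := not_eq_iff_eq_not' h4
      cases h5 : x0 k <;> simp_all [min3]
    · have := h2 l hl
      have := not_eq_iff_eq_not' h3
      cases h5 : x0 l <;> simp_all [min3]

theorem red_S2 {V : Type} [Finite V] {ρ : Set (V → Bool)} {t : V → Bool} (hne : ρ.Nonempty)
    (hmaj : ∀ x ∈ ρ, ∀ y ∈ ρ, ∀ z ∈ ρ, (fun i => maj3 (x i) (y i) (z i)) ∈ ρ)
    (hmin : ∀ x ∈ ρ, ∀ y ∈ ρ, ∀ z ∈ ρ, (fun i => min3 (x i) (y i) (z i)) ∈ ρ)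
    (hsep : ∀ v w : V, (∀ x ∈ ρ, x v = x w) → v = w) (p q : V)
    (hp : ¬ CC ρ p) (hq : ¬ CC ρ q) (hpq : ∀ x ∈ ρ, x q = !x p)
    (hv : t p = t q ∨ ∃ i c, (∀ x ∈ ρ, x i = c) ∧ t i ≠ c) : Red ρ t := by
  classical
  obtain ⟨x0, hx0⟩ := hne
  refine red_of hsep (fun k => if CC ρ k then k else if x0 k = x0 p then p else q) p q ?_ ?_ ?_
  · intro k
    by_cases h : CC ρ k
    · exact Or.inr (Or.inr ⟨by simp [h], h⟩)
    · by_cases h2 : x0 k = x0 p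
      · exact Or.inl (by simp [h, h2])
      · exact Or.inr (Or.inl (by simp [h, h2]))
  · intro x hx
    have hq1 := hpq x hx
    by_cases h : x p = x0 p
    · convert hx0 using 1
      funext k
      by_cases hk : CC ρ k
      · simp only [hk, if_true]
        obtain ⟨c, hc⟩ := hk
        rw [hc _ hx, hc _ hx0]
      · simp only [hk, if_false]
        by_cases h2 : x0 k = x0 p
        · rw [if_pos h2, h, h2]
        · rw [if_neg h2, hq1, h, not_eq_iff_eq_not' h2]
    · refine flip_S hmaj hmin _ x0 hx0 ?_ ?_
      · intro k hk
        simp only [hk, if_true]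
        obtain ⟨c, hc⟩ := hk
        rw [hc _ hx, hc _ hx0]
      · intro k hk
        simp only [hk, if_false]
        have h' := not_eq_iff_eq_not' h
        by_cases h2 : x0 k = x0 p
        · rw [if_pos h2, h', h2]
        · rw [if_neg h2, hq1, h', not_eq_iff_eq_not' h2]
  · intro h
    rcases hv with hv | ⟨i, c, hi, hc⟩
    · have := hpq _ h
      have h3 : ¬ (x0 q = x0 p) := by rw [hpq _ hx0]; simp
      simp only [hp, hq, if_false, h3, if_true] at this
      rw [hv] at this
      simp at this
    · have := hi _ h
      have h2 : CC ρ i := ⟨c, hi⟩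
      simp only [h2, if_true] at this
      exact hc this

theorem bl1 : ∀ ui uj vi vj xi xj ti tj : Bool, ui = ti → uj ≠ tj → vi ≠ ti → vj = tj →
    (xi = ti → xj ≠ tj) → (min3 ui vi xi = ti → min3 uj vj xj ≠ tj) →
    xor xi xj = !(xor ti tj) := by
  rintro ui uj vi vj xi xj ti tj rfl h1 h2 rfl
  cases ui <;> cases uj <;> cases vi <;> cases vj <;> cases xi <;> cases xj <;> simp_all [min3]
theorem bl2 : ∀ u v x c : Bool, u = c → ¬ v = c → ¬ x = c → min3 u v x = c := by decide
theorem bl3 : ∀ u v x y c : Bool, ¬ u = c → v = c → ¬ y = c → x ≠ !y → min3 u v x = c := by decide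
theorem bl4 : ∀ x y c : Bool, y = c → x ≠ !y → x = c := by decide
theorem bl5 : ∀ x y t : Bool, xor x y = (!(xor t t)) → y = !x := by decide
theorem bl6 : ∀ x y t s : Bool, ¬ t = s → xor x y = (!(xor t s)) → x = y := by decide

theorem red_S {V : Type} [Finite V] {ρ : Set (V → Bool)} {t : V → Bool} (hne : ρ.Nonempty)
    (hmaj : ∀ x ∈ ρ, ∀ y ∈ ρ, ∀ z ∈ ρ, (fun i => maj3 (x i) (y i) (z i)) ∈ ρ)
    (hmin : ∀ x ∈ ρ, ∀ y ∈ ρ, ∀ z ∈ ρ, (fun i => min3 (x i) (y i) (z i)) ∈ ρ)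
    (hsep : ∀ v w : V, (∀ x ∈ ρ, x v = x w) → v = w) (ht : t ∉ ρ) : Red ρ t := by
  by_cases hc : ∃ i, ∀ x ∈ ρ, x i ≠ t i
  · obtain ⟨i, hi⟩ := hc
    have hi2 : ∀ x ∈ ρ, x i = !t i := fun x hx => not_eq_iff_eq_not' (hi x hx)
    by_cases hh : ∃ p q, ¬ CC ρ p ∧ ¬ CC ρ q ∧ ∀ x ∈ ρ, x q = !x p
    · obtain ⟨p, q, hp, hq, hpq⟩ := hh
      exact red_S2 hne hmaj hmin hsep p q hp hq hpq (Or.inr ⟨i, _, hi2, by simp⟩)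
    · refine red_const hmaj hsep i (!t i) hi2 (by simp) ?_
      generalize (!t i) = c
      intro k l hk hl
      obtain ⟨u, hu, hu2⟩ := nCC hk c
      obtain ⟨v, hv, hv2⟩ := nCC hl c
      have : ¬ ∀ x ∈ ρ, x l = !x k := fun h => hh ⟨k, l, hk, hl, h⟩
      push Not at this
      obtain ⟨x, hx, hx2⟩ := this
      by_cases h3 : u l = c
      · exact ⟨u, hu, hu2, h3⟩
      by_cases h4 : v k = c
      · exact ⟨v, hv, h4, hv2⟩
      by_cases h5 : x k = c
      · refine ⟨x, hx, h5, ?_⟩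
        exact bl4 _ _ _ h5 hx2
      exact ⟨_, hmin u hu v hv x hx, bl2 _ _ _ _ hu2 h4 h5, bl3 _ _ _ _ _ h3 hv2 h5 hx2⟩
  · push Not at hc
    have hb : ¬ ∀ i j, ∃ x ∈ ρ, x i = t i ∧ x j = t j := fun h => ht (baker_pixley hne hmaj t h)
    push Not at hb
    obtain ⟨i, j, hij⟩ := hb
    obtain ⟨u, hu, hui⟩ := hc i
    obtain ⟨v, hv, hvj⟩ := hc j
    have huj := hij u hu hui
    have hvi : v i ≠ t i := fun h => hij v hv h hvj
    have hi : ¬ CC ρ i := by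
      rintro ⟨c, h⟩
      exact hvi ((h v hv).trans ((h u hu).symm.trans hui))
    have hj : ¬ CC ρ j := by
      rintro ⟨c, h⟩
      exact huj ((h u hu).trans ((h v hv).symm.trans hvj))
    have hx3 : ∀ x ∈ ρ, xor (x i) (x j) = !(xor (t i) (t j)) := by
      intro x hx
      have h1 := hij x hx
      have h2 := hij _ (hmin u hu v hv x hx)
      exact bl1 _ _ _ _ _ _ _ _ hui huj hvi hvj h1 h2
    by_cases hte : t i = t j
    · refine red_S2 hne hmaj hmin hsep i j hi hj ?_ (Or.inl hte)
      intro x hx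
      have := hx3 x hx
      rw [hte] at this
      exact bl5 _ _ _ this
    · exfalso
      apply hte
      rw [hsep i j]
      intro x hx
      exact bl6 _ _ _ _ hte (hx3 x hx)

def Phi (X : Set (PF Bool)) : Set (Set (Fin 4 → Bool)) := {ρ | ∀ f ∈ X, GPres f ρ}

theorem Phi_spec {X : Set (PF Bool)} (hX : IsPartialClone X) (hS : IsStrong X)
    (hred : ∀ (V : Type) [Finite V] (ρ : Set (V → Bool)) (t : V → Bool), ρ.Nonempty →
      (∀ h ∈ X, GPres h ρ) → (∀ v w : V, (∀ x ∈ ρ, x v = x w) → v = w) → t ∉ ρ → Red ρ t)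
    (f : PF Bool) (hf : ∀ ρ ∈ Phi X, GPres f ρ) : f ∈ X := by
  by_contra hfX
  obtain ⟨n, f⟩ := f
  let V := {a : Fin (n+1) → Bool // (f a).isSome}
  let ρ : Set (V → Bool) := {x | ∃ g, (⟨n, g⟩ : PF Bool) ∈ X ∧ ∀ v : V, g v.1 = some (x v)}
  let t : V → Bool := fun v => (f v.1).get v.2
  have hpr : ∀ j : Fin (n+1), (fun v : V => v.1 j) ∈ ρ := fun j =>
    ⟨fun a => some (a j), hX.1 n j, fun v => rfl⟩
  have hGP : ∀ h ∈ X, GPres h ρ := by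
    intro h hh M v h1 h2
    choose g hg hg2 using h1
    refine ⟨compFun h.2 g, hX.2 h hh n g hg, fun w => ?_⟩
    rw [compFun_some_iff]
    exact ⟨M w, fun i => hg2 i w, h2 w⟩
  have ht : t ∉ ρ := by
    rintro ⟨g, hg, hg2⟩
    apply hfX
    refine strong_elim hS hg ?_
    intro x a hx
    have := hg2 ⟨x, by simp [hx]⟩
    rw [this]
    simp [t, hx]
  obtain ⟨φ, ψ, h1, h2⟩ := hred V ρ t ⟨_, hpr 0⟩ hGP
    (fun v w h => Subtype.ext (funext fun j => h _ (hpr j))) ht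
  have h3 : {y : Fin 4 → Bool | (fun k => y (φ k)) ∈ ρ} ∈ Phi X := by
    intro h hh M v hM hv
    exact hGP h hh (fun k => M (φ k)) (fun k => v (φ k)) hM (fun i => hv _)
  have h4 := hf _ h3 (fun k => (ψ k).1) (fun k => t (ψ k)) (fun j => h1 _ (hpr j)) (fun i => by simp [t])
  exact h2 h4

theorem Istr_finite {C : Set (PF Bool)}
    (hred : ∀ X ∈ Istr C, ∀ (V : Type) [Finite V] (ρ : Set (V → Bool)) (t : V → Bool), ρ.Nonempty →
      (∀ h ∈ X, GPres h ρ) → (∀ v w : V, (∀ x ∈ ρ, x v = x w) → v = w) → t ∉ ρ → Red ρ t) :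
    (Istr C).Finite := by
  refine Set.Finite.of_injOn (f := Phi) (t := Set.univ) (fun _ _ => Set.mem_univ _) ?_ Set.finite_univ
  intro X hX Y hY hXY
  have hs : ∀ X ∈ Istr C, ∀ Y ∈ Istr C, Phi X = Phi Y → Y ⊆ X := by
    intro X hX Y hY hXY f hf
    refine Phi_spec hX.1 hX.2.1 (hred X hX) f ?_
    intro ρ hρ
    rw [hXY] at hρ
    exact hρ f hf
  exact Set.Subset.antisymm (hs Y hY X hX hXY.symm) (hs X hX Y hY hXY)

theorem cl2 {X : Set (PF Bool)} {u : Bool → Bool → Bool}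
    (hu : tot (fun x : Fin 2 → Bool => u (x 0) (x 1)) ∈ X) {V : Type} {ρ : Set (V → Bool)}
    (h : ∀ h ∈ X, GPres h ρ) : ∀ x ∈ ρ, ∀ y ∈ ρ, (fun i => u (x i) (y i)) ∈ ρ := by
  intro x hx y hy
  refine h _ hu (fun i => ![x i, y i]) _ ?_ (fun i => rfl)
  refine Fin.forall_fin_two.2 ⟨?_, ?_⟩
  · exact hx
  · exact hy

theorem cl3 {X : Set (PF Bool)} {u : Bool → Bool → Bool → Bool}
    (hu : tot (fun x : Fin 3 → Bool => u (x 0) (x 1) (x 2)) ∈ X) {V : Type} {ρ : Set (V → Bool)}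
    (h : ∀ h ∈ X, GPres h ρ) : ∀ x ∈ ρ, ∀ y ∈ ρ, ∀ z ∈ ρ, (fun i => u (x i) (y i) (z i)) ∈ ρ := by
  intro x hx y hy z hz
  refine h _ hu (fun i => ![x i, y i, z i]) _ ?_ (fun i => rfl)
  intro j
  change Fin 3 at j
  fin_cases j
  · exact hx
  · exact hy
  · exact hz

theorem mem_T0 {n : ℕ} {F : (Fin (n+1) → Bool) → Bool} :
    tot F ∈ T0 ↔ F (fun _ => false) = false := by
  constructor
  · rintro ⟨h, -⟩
    have := h (fun _ _ => false) (fun _ => F (fun _ => false)) (fun j => by simp [relT0]) (fun i => rfl)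
    simp only [relT0, Set.mem_singleton_iff] at this
    exact congrFun this 0
  · intro h
    refine ⟨?_, tot_mem_OSet F⟩
    intro M v h1 h2
    simp only [relT0, Set.mem_singleton_iff] at h1 ⊢
    funext i
    have h3 := Option.some.inj (h2 i)
    have h4 : M i = fun _ => false := by
      funext j
      exact congrFun (h1 j) i
    rw [h4] at h3
    exact h3.symm.trans h

theorem mem_T1 {n : ℕ} {F : (Fin (n+1) → Bool) → Bool} :
    tot F ∈ T1 ↔ F (fun _ => true) = true := by
  constructor
  · rintro ⟨h, -⟩
    have := h (fun _ _ => true) (fun _ => F (fun _ => true)) (fun j => by simp [relT1]) (fun i => rfl)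
    simp only [relT1, Set.mem_singleton_iff] at this
    exact congrFun this 0
  · intro h
    refine ⟨?_, tot_mem_OSet F⟩
    intro M v h1 h2
    simp only [relT1, Set.mem_singleton_iff] at h1 ⊢
    funext i
    have h3 := Option.some.inj (h2 i)
    have h4 : M i = fun _ => true := by
      funext j
      exact congrFun (h1 j) i
    rw [h4] at h3
    exact h3.symm.trans h

theorem mem_relM (v : Fin 2 → Bool) : v ∈ relM ↔ (v 0 = true → v 1 = true) := by
  simp only [relM, Set.mem_insert_iff, Set.mem_singleton_iff, funext_iff, Fin.forall_fin_two]
  cases v 0 <;> cases v 1 <;> simp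

theorem mem_relS (v : Fin 2 → Bool) : v ∈ relS ↔ v 1 = !v 0 := by
  simp only [relS, Set.mem_insert_iff, Set.mem_singleton_iff, funext_iff, Fin.forall_fin_two]
  cases v 0 <;> cases v 1 <;> simp

theorem mem_M {n : ℕ} {F : (Fin (n+1) → Bool) → Bool} :
    tot F ∈ Mclone ↔ ∀ a b, (∀ i, a i = true → b i = true) → F a = true → F b = true := by
  constructor
  · rintro ⟨h, -⟩ a b hab
    have := h ![a, b] ![F a, F b] (fun j => by rw [mem_relM]; exact hab j)
      (Fin.forall_fin_two.2 ⟨rfl, rfl⟩)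
    rw [mem_relM] at this
    exact this
  · intro h
    refine ⟨?_, tot_mem_OSet F⟩
    intro M v h1 h2
    rw [mem_relM, ← Option.some.inj (h2 0), ← Option.some.inj (h2 1)]
    exact h _ _ fun i => (mem_relM _).1 (h1 i)

theorem mem_S {n : ℕ} {F : (Fin (n+1) → Bool) → Bool} :
    tot F ∈ Sclone ↔ ∀ a, F (fun i => !a i) = !F a := by
  constructor
  · rintro ⟨h, -⟩ a
    have := h ![a, fun i => !a i] ![F a, F (fun i => !a i)] (fun j => by rw [mem_relS]; rfl)
      (Fin.forall_fin_two.2 ⟨rfl, rfl⟩)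
    rw [mem_relS] at this
    exact this
  · intro h
    refine ⟨?_, tot_mem_OSet F⟩
    intro M v h1 h2
    rw [mem_relS, ← Option.some.inj (h2 0), ← Option.some.inj (h2 1)]
    have : M 1 = fun i => !M 0 i := funext fun i => (mem_relS _).1 (h1 i)
    rw [this]
    exact h _

theorem fin_M {C : Set (PF Bool)} (h : Mclone ∩ T0 ∩ T1 ⊆ C) : (Istr C).Finite := by
  have h1 : tot (fun x : Fin 2 → Bool => and (x 0) (x 1)) ∈ C := by
    refine h ⟨⟨mem_M.2 ?_, mem_T0.2 rfl⟩, mem_T1.2 rfl⟩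
    intro a b hab
    simp only [Bool.and_eq_true]
    exact fun ⟨p, q⟩ => ⟨hab _ p, hab _ q⟩
  have h2 : tot (fun x : Fin 2 → Bool => or (x 0) (x 1)) ∈ C := by
    refine h ⟨⟨mem_M.2 ?_, mem_T0.2 rfl⟩, mem_T1.2 rfl⟩
    intro a b hab
    simp only [Bool.or_eq_true]
    exact fun p => p.imp (hab _) (hab _)
  refine Istr_finite ?_
  intro X hX V _ ρ t hne hP hsep ht
  have hCX : C ⊆ X := by
    rw [← hX.2.2]
    exact Set.inter_subset_left
  exact red_M hne (cl2 (hCX h1) hP) (cl2 (hCX h2) hP) hsep ht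

theorem fin_S {C : Set (PF Bool)} (h : Sclone ∩ T0 ∩ T1 ⊆ C) : (Istr C).Finite := by
  have h1 : tot (fun x : Fin 3 → Bool => maj3 (x 0) (x 1) (x 2)) ∈ C := by
    refine h ⟨⟨mem_S.2 ?_, mem_T0.2 rfl⟩, mem_T1.2 rfl⟩
    intro a
    beta_reduce
    cases a 0 <;> cases a 1 <;> cases a 2 <;> rfl
  have h2 : tot (fun x : Fin 3 → Bool => min3 (x 0) (x 1) (x 2)) ∈ C := by
    refine h ⟨⟨mem_S.2 ?_, mem_T0.2 rfl⟩, mem_T1.2 rfl⟩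
    intro a
    beta_reduce
    cases a 0 <;> cases a 1 <;> cases a 2 <;> rfl
  refine Istr_finite ?_
  intro X hX V _ ρ t hne hP hsep ht
  have hCX : C ⊆ X := by
    rw [← hX.2.2]
    exact Set.inter_subset_left
  exact red_S hne (cl3 (hCX h1) hP) (cl3 (hCX h2) hP) hsep ht

theorem inf_case {C : Set (PF Bool)} (hC : IsClone C)
    (h : ¬ (Mclone ∩ T0 ∩ T1 ⊆ C ∨ Sclone ∩ T0 ∩ T1 ⊆ C)) :
    Cardinal.continuum ≤ Cardinal.mk ↥(Istr C) := by
  by_cases a1 : ∀ n (F : (Fin (n+1) → Bool) → Bool), tot F ∈ C → IsT02 F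
  · exact continuum_T02 hC a1
  by_cases a2 : ∀ n (F : (Fin (n+1) → Bool) → Bool), tot F ∈ C → IsT12 F
  · exact continuum_T12 hC a2
  by_cases a3 : ∀ n (F : (Fin (n+1) → Bool) → Bool), tot F ∈ C → IsL F
  · exact continuum_L hC a3
  by_cases a4 : ∀ n (F : (Fin (n+1) → Bool) → Bool), tot F ∈ C → IsMeet F
  · exact continuum_Meet hC a4
  by_cases a5 : ∀ n (F : (Fin (n+1) → Bool) → Bool), tot F ∈ C → IsJoin F
  · exact continuum_Join hC a5
  exfalso
  apply h
  rcases post_case hC a1 a2 a3 a4 a5 with ⟨p, q⟩ | ⟨p, q⟩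
  · left
    rintro f ⟨⟨hm, h0⟩, h1⟩
    obtain ⟨n, F, rfl⟩ := exists_tot hm.2
    exact gen_M hC p q F (mem_T0.1 h0) (mem_T1.1 h1) (mem_M.1 hm)
  · right
    rintro f ⟨⟨hm, h0⟩, h1⟩
    obtain ⟨n, F, rfl⟩ := exists_tot hm.2
    exact gen_S hC p q F (mem_T0.1 h0) (mem_T1.1 h1) (mem_S.1 hm)

theorem final_dich (C : Set (PF Bool)) (hC : IsClone C) :
    ((Istr C).Finite ∨ Cardinal.mk ↥(Istr C) = Cardinal.continuum) ∧
    ((Istr C).Finite ↔ (Mclone ∩ T0 ∩ T1 ⊆ C ∨ Sclone ∩ T0 ∩ T1 ⊆ C)) := by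
  by_cases h : Mclone ∩ T0 ∩ T1 ⊆ C ∨ Sclone ∩ T0 ∩ T1 ⊆ C
  · have hf : (Istr C).Finite := h.elim fin_M fin_S
    exact ⟨Or.inl hf, fun _ => h, fun _ => hf⟩
  · have hc := inf_case hC h
    refine ⟨Or.inr (le_antisymm (Istr_le C) hc), fun hf => ?_, fun h' => absurd h' h⟩
    have := Cardinal.lt_aleph0_iff_set_finite.2 hf
    exact absurd (Cardinal.aleph0_le_continuum.trans hc) (not_le.2 this)

/-- Dichotomy for intervals of strong partial Boolean clones. -/
theorem dichotomy_strong_partial_clones (C : Set (PF Bool)) (hC : IsClone C) :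
    ((Istr C).Finite ∨ Cardinal.mk ↥(Istr C) = Cardinal.continuum) ∧
    ((Istr C).Finite ↔ (Mclone ∩ T0 ∩ T1 ⊆ C ∨ Sclone ∩ T0 ∩ T1 ⊆ C)) := by
  exact final_dich C hC

end StrongPartial
end

section
/- Let A be a finite set, h ≥ 1, and ρ', ρ, σ', σ ⊆ A^h with ρ' ⊆ ρ, σ' ⊆ σ, and σ' ⊆ ρ ⊆ σ. If f ∈ cPol(ρ,ρ') and g ∈ cPol(σ,σ'), then f⋆g ∈ cPol(ρ,ρ'). -/
namespace StrongPartial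

variable {A : Type}

theorem star_mem_cPol_pair {A : Type} [Fintype A] {h : ℕ} (hh : 1 ≤ h)
    (ρ ρ' σ σ' : Set (Fin h → A)) (hρ : ρ' ⊆ ρ) (hσ : σ' ⊆ σ)
    (hσ'ρ : σ' ⊆ ρ) (hρσ : ρ ⊆ σ) (f g : PF A)
    (hf : f ∈ cPolSet ρ ρ') (hg : g ∈ cPolSet σ σ') :
    starPF f g ∈ cPolSet ρ ρ' := by
  intro M v hM hv
  have hv' : ∀ i, ∃ a, g.2 (fun j => M i ⟨j.val, by have := j.isLt; simp only [starPF]; omega⟩) = some a ∧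
      f.2 (fun k => if k.val = 0 then a else
        M i ⟨g.1 + k.val, by have := k.isLt; simp only [starPF]; omega⟩) = some (v i) := by
    intro i
    exact Option.bind_eq_some_iff.mp (hv i)
  choose w hw1 hw2 using hv'
  have hw : w ∈ ρ := hσ'ρ (hg _ w (fun j => hρσ (hM _)) hw1)
  refine hf _ v (fun k => ?_) hw2
  by_cases hk : k.val = 0
  · simpa only [hk, if_true] using hw
  · simp only [hk, if_false]
    exact hM _

end StrongPartial
end

section
/- Let A be a finite set, C and D total clones on A with D ⊆ C, T a strong partial class of P_A, and I ⊆ I_str(C) such that: (i) T ∩ O_A ⊆ D; (ii) T⋆Str(D) ⊆ Str(D) ∪ T and Str(D)⋆T ⊆ Str(D) ∪ T; and (iii) X ∩ T ≠ Y ∩ T for all X, Y ∈ I with X ≠ Y. Then |I_str(D)| ≥ |I|. -/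
namespace StrongPartial

variable {A : Type}

/-- `σ` is an admissible change of variables for `T`. -/
def Mn (T : Set (PF A)) (n m : ℕ) (σ : Fin (n+1) → Fin (m+1)) : Prop :=
  ∀ f : (Fin (n+1) → A) → Option A, (⟨n, f⟩ : PF A) ∈ T →
    (⟨m, fun x => f (fun i => x (σ i))⟩ : PF A) ∈ T

theorem Mn.comp {T : Set (PF A)} {n m k : ℕ} {σ : Fin (n+1) → Fin (m+1)}
    {ρ : Fin (m+1) → Fin (k+1)} (h2 : Mn T m k ρ) (h1 : Mn T n m σ) :
    Mn T n k (fun i => ρ (σ i)) := by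
  intro f hf
  exact h2 _ (h1 f hf)

theorem Mn.id {T : Set (PF A)} {n : ℕ} : Mn T n n (fun i => i) := fun _ hf => hf

theorem Mn_perm {T : Set (PF A)} (hT : IsPartialClass T) (n : ℕ) (σ : Equiv.Perm (Fin (n+1))) :
    Mn T n n σ := by
  obtain ⟨hz, ht, -, -, -⟩ := hT
  rcases n with _ | n
  · have : (σ : Fin (0+1) → Fin (0+1)) = fun i => i := by
      funext i; exact Fin.ext (by have := i.isLt; have := (σ i).isLt; omega)
    rw [this]; exact Mn.id
  have hcl : Subgroup.closure ({finRotate (n+2), Equiv.swap 0 (finRotate (n+2) 0)} :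
      Set (Equiv.Perm (Fin (n+2)))) = ⊤ :=
    Equiv.Perm.closure_cycle_adjacent_swap isCycle_finRotate support_finRotate 0
  have hmem : σ ∈ Submonoid.closure ({finRotate (n+2), Equiv.swap 0 (finRotate (n+2) 0)} :
      Set (Equiv.Perm (Fin (n+2)))) := by
    rw [← Subgroup.closure_toSubmonoid_of_finite, hcl]
    trivial
  induction hmem using Submonoid.closure_induction with
  | mem x hx =>
    rcases hx with rfl | hx
    · intro f hf
      have := hz _ hf
      have he : ∀ i : Fin (n+2), finRotate (n+2) i = i + 1 := fun i => finRotate_apply i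
      simp only [he]
      exact this
    · rw [Set.mem_singleton_iff] at hx
      subst hx
      intro f hf
      have := ht _ hf
      have he : finRotate (n+2) 0 = 1 := by simp
      rw [he]
      exact this
  | one => exact Mn.id
  | mul x y _ _ hx hy =>
    have := Mn.comp hx hy
    exact this

theorem Mn_succ {T : Set (PF A)} (hT : IsPartialClass T) (n : ℕ) :
    Mn T n (n+1) Fin.succ := by
  intro f hf
  exact hT.2.2.2.1 _ hf

theorem Mn_pred {T : Set (PF A)} (hT : IsPartialClass T) (n : ℕ) :
    Mn T (n+1) n (fun i => ⟨i.val - 1, by have := i.isLt; omega⟩) := by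
  intro f hf
  exact hT.2.2.1 _ hf

theorem Mn_shift {T : Set (PF A)} (hT : IsPartialClass T) (n k : ℕ) :
    ∃ e, Mn T n (n+k) e ∧ ∀ i, (e i).val = i.val + k := by
  induction k with
  | zero => exact ⟨_, Mn.id, fun i => rfl⟩
  | succ k ih =>
    obtain ⟨e, he, h⟩ := ih
    refine ⟨_, Mn.comp (Mn_succ hT (n+k)) he, fun i => ?_⟩
    simp [h]; omega

theorem Mn_drop {T : Set (PF A)} (hT : IsPartialClass T) (m k : ℕ) :
    ∃ d, Mn T (m+k) m d ∧ ∀ i, i.val ≤ m → (d i).val = i.val := by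
  induction k with
  | zero => exact ⟨_, Mn.id, fun i _ => rfl⟩
  | succ k ih =>
    obtain ⟨e, he, h⟩ := ih
    refine ⟨_, Mn.comp he (Mn.comp (Mn_pred hT (m+k)) (Mn_perm hT (m+k+1) (finRotate _))),
      fun i hi => ?_⟩
    have : ((finRotate (m+k+1+1) i)).val = i.val + 1 := by
      rw [coe_finRotate_of_ne_last]
      intro hh
      have := congrArg Fin.val hh
      simp at this
      omega
    rw [h]
    · show (finRotate (m+k+1+1) i).val - 1 = i.val
      omega
    · show (finRotate (m+k+1+1) i).val - 1 ≤ m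
      omega

theorem Mn_merge {T : Set (PF A)} (hT : IsPartialClass T) (n : ℕ) (a b : Fin (n+1)) (hab : a ≠ b) :
    Mn T n n (fun i => if i = a then b else i) := by
  rcases n with _ | n
  · exact absurd (Fin.ext (by have := a.isLt; have := b.isLt; omega)) hab
  have hbase := Mn.comp (Mn_succ hT n) (Mn_pred hT n)
  obtain ⟨π, h0, h1⟩ : ∃ π : Equiv.Perm (Fin (n+2)), π a = 0 ∧ π b = 1 := by
    refine ⟨(Equiv.swap a 0).trans (Equiv.swap (Equiv.swap a 0 b) 1), ?_, ?_⟩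
    · simp only [Equiv.trans_apply, Equiv.swap_apply_left]
      rw [Equiv.swap_apply_of_ne_of_ne]
      · intro hh
        have := congrArg (Equiv.swap a 0) hh
        simp at this
        exact hab this
      · simp
    · simp
  have := Mn.comp (Mn_perm hT _ π.symm) (Mn.comp hbase (Mn_perm hT _ π))
  convert this using 2 with i
  split_ifs with hi
  · subst hi
    rw [h0, Equiv.eq_symm_apply, h1]; ext; simp
  · rw [Equiv.eq_symm_apply]
    have : π i ≠ 0 := by rw [← h0]; simpa using hi
    ext
    have : (π i).val ≠ 0 := by
      intro hh; exact this (Fin.ext hh)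
    simp; omega

theorem Mn_all {T : Set (PF A)} (hT : IsPartialClass T) {n m : ℕ} (σ : Fin (n+1) → Fin (m+1)) :
    Mn T n m σ := by
  obtain ⟨e, he, hev⟩ := Mn_shift hT n (m+1)
  obtain ⟨d, hd, hdv⟩ := Mn_drop hT m (n+1)
  have hN : m + (n+1) = n + (m+1) := by omega
  have key : ∀ t ≤ n+1, ∃ r, Mn T n (n+(m+1)) r ∧ ∀ i : Fin (n+1),
      (i.val < t → (r i).val = (σ i).val) ∧ (t ≤ i.val → (r i).val = i.val + (m+1)) := by
    intro t
    induction t with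
    | zero => intro _; exact ⟨e, he, fun i => ⟨fun h => absurd h (by omega), fun _ => hev i⟩⟩
    | succ t ih =>
      intro ht
      obtain ⟨r, hr, hrv⟩ := ih (by omega)
      have hs := (σ ⟨t, by omega⟩).isLt
      refine ⟨_, Mn.comp (Mn_merge hT (n+(m+1)) ⟨t+(m+1), by omega⟩
        ⟨(σ ⟨t, by omega⟩).val, by omega⟩ (by simp; omega)) hr, fun i => ?_⟩
      have hsi := (σ i).isLt
      have hri := hrv i
      have hext : r i = ⟨t+(m+1), by omega⟩ ↔ (r i).val = t+(m+1) := by rw [Fin.ext_iff]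
      split_ifs with hc
      · rw [hext] at hc
        have : i.val = t := by
          by_contra hne
          rcases Nat.lt_or_gt_of_ne hne with h | h
          · have := hri.1 h; omega
          · have := hri.2 h.le; omega
        have : i = ⟨t, ht⟩ := Fin.ext this
        subst this
        simp
      · rw [hext] at hc
        constructor
        · intro h
          apply hri.1
          by_contra hne
          have := hri.2 (by omega)
          omega
        · intro h; exact hri.2 (by omega)
  obtain ⟨r, hr, hrv⟩ := key (n+1) le_rfl
  revert d
  rw [hN]
  intro d hd hdv
  have := Mn.comp hd hr
  convert this using 2 with i
  ext
  have h1 := (hrv i).1 i.isLt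
  rw [hdv _ (by rw [h1]; omega), h1]

theorem compFun_eq_some {k m : ℕ} (f : (Fin k → A) → Option A)
    (g : Fin k → ((Fin m → A) → Option A)) (x : Fin m → A) (b : A) :
    compFun f g x = some b ↔ ∃ w : Fin k → A, (∀ i, g i x = some (w i)) ∧ f w = some b := by
  unfold compFun
  constructor
  · intro h
    split_ifs at h with hs
    exact ⟨_, fun i => by simp, h⟩
  · rintro ⟨w, hw, hf⟩
    have hs : ∀ i, (g i x).isSome := fun i => by simp [hw i]
    rw [dif_pos hs]
    convert hf using 2
    funext i
    simp [hw i]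

/-- Minor-closed + star-closed sets with projections are partial clones. -/
theorem clone_of_maltsev {Y : Set (PF A)} (hp : ∀ (n : ℕ) (i : Fin (n+1)), proj n i ∈ Y)
    (hm : ∀ (n m : ℕ) (σ : Fin (n+1) → Fin (m+1)), Mn Y n m σ)
    (hs : ∀ f ∈ Y, ∀ g ∈ Y, starPF f g ∈ Y) : IsPartialClone Y := by
  have hsub : ∀ (N : ℕ) (p : Fin (N+1)) (h g : (Fin (N+1) → A) → Option A),
      (⟨N, h⟩ : PF A) ∈ Y → (⟨N, g⟩ : PF A) ∈ Y →
      (⟨N, fun x => (g x).bind (fun a => h (Function.update x p a))⟩ : PF A) ∈ Y := by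
    intro N p h g hh hg
    have h1 := hm N (N+1) (fun i => if i = p then 0 else i.succ) h hh
    have h2 := hs _ h1 _ hg
    have h3 := hm (N+1+N) N (fun i => if hi : i.val ≤ N then ⟨i.val, by omega⟩ else
      ⟨i.val - (N+1), by have := i.isLt; omega⟩) _ h2
    convert h3 using 3 with x
    congr 1
    · congr 1
      funext j
      have := j.isLt
      simp [show j.val ≤ N by omega]
    · funext a
      congr 1
      funext i
      by_cases hi : i = p
      · subst hi; simp
      · simp only [Function.update_of_ne hi, hi, if_false]
        simp only [Fin.val_succ, Nat.add_eq_zero_iff, one_ne_zero, and_false, if_false]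
        rw [dif_neg (by omega)]
        congr 1
        ext; simp; omega
  refine ⟨hp, ?_⟩
  rintro ⟨n, f⟩ hf m g hg
  simp only at g hg ⊢
  -- variables: y_0..y_n, x_0..x_m
  let ix : Fin (m+1) → Fin (n+1+m+1) := fun j => ⟨n+1+j.val, by have := j.isLt; omega⟩
  let iy : Fin (n+1) → Fin (n+1+m+1) := fun j => ⟨j.val, by have := j.isLt; omega⟩
  have key : ∀ t ≤ n+1, ∃ h : (Fin (n+1+m+1) → A) → Option A, (⟨n+1+m, h⟩ : PF A) ∈ Y ∧
      ∀ z b, h z = some b ↔ ∃ w : Fin (n+1) → A,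
        (∀ i, i.val < t → g i (fun j => z (ix j)) = some (w i)) ∧
        (∀ i, t ≤ i.val → w i = z (iy i)) ∧ f w = some b := by
    intro t
    induction t with
    | zero =>
      intro _
      refine ⟨_, hm n (n+1+m) iy f hf, fun z b => ⟨fun h => ⟨_, by simp, fun i _ => rfl, h⟩, ?_⟩⟩
      rintro ⟨w, -, hw, h⟩
      have : w = fun i => z (iy i) := funext fun i => hw i (Nat.zero_le _)
      rw [← this]; exact h
    | succ t ih =>
      intro ht
      obtain ⟨h, hh, hv⟩ := ih (by omega)
      refine ⟨_, hsub _ (iy ⟨t, by omega⟩) _ _ hh (hm m (n+1+m) ix _ (hg ⟨t, by omega⟩)),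
        fun z b => ?_⟩
      have hux : ∀ a, (fun j => Function.update z (iy ⟨t, by omega⟩) a (ix j)) =
          fun j => z (ix j) := by
        intro a; funext j
        rw [Function.update_of_ne]
        simp only [ix, iy, ne_eq, Fin.mk.injEq]; omega
      have huy : ∀ a (i : Fin (n+1)), i.val ≠ t →
          Function.update z (iy ⟨t, by omega⟩) a (iy i) = z (iy i) := by
        intro a i hi
        rw [Function.update_of_ne]
        simp only [iy, ne_eq, Fin.mk.injEq]; exact hi
      rw [Option.bind_eq_some_iff]
      constructor
      · rintro ⟨a, ha, hb⟩
        rw [hv] at hb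
        obtain ⟨w, hw1, hw2, hw3⟩ := hb
        rw [hux] at hw1
        refine ⟨w, fun i hi => ?_, fun i hi => ?_, hw3⟩
        · by_cases hit : i.val = t
          · have : i = ⟨t, ht⟩ := Fin.ext hit
            subst this
            rw [ha, hw2 _ le_rfl, Function.update_self]
          · exact hw1 i (by omega)
        · rw [hw2 i (by omega), huy _ _ (by omega)]
      · rintro ⟨w, hw1, hw2, hw3⟩
        refine ⟨w ⟨t, by omega⟩, hw1 _ (by simp), ?_⟩
        rw [hv]
        refine ⟨w, fun i hi => ?_, fun i hi => ?_, hw3⟩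
        · rw [hux]; exact hw1 i (by omega)
        · by_cases hit : i.val = t
          · have : i = ⟨t, ht⟩ := Fin.ext hit
            subst this
            rw [Function.update_self]
          · rw [huy _ _ hit]; exact hw2 i (by omega)
  obtain ⟨h, hh, hv⟩ := key (n+1) le_rfl
  have h4 := hm (n+1+m) m (fun i => if hi : i.val < n+1 then 0 else
      ⟨i.val - (n+1), by have := i.isLt; omega⟩) h hh
  convert h4 using 2
  funext x
  apply Option.ext
  intro b
  rw [compFun_eq_some, hv]
  have hx : (fun j => x ((fun i : Fin (n+1+m+1) => if hi : i.val < n+1 then (0 : Fin (m+1)) else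
      ⟨i.val - (n+1), by have := i.isLt; omega⟩) (ix j))) = x := by
    funext j
    have hlt : ¬ (n + 1 + j.val < n + 1) := by omega
    simp only [ix, hlt, dif_neg, not_false_eq_true, Nat.add_sub_cancel_left]
  constructor
  · rintro ⟨w, hw, hb⟩
    exact ⟨w, fun i _ => by rw [hx]; exact hw i, fun i hi => absurd i.isLt (by omega), hb⟩
  · rintro ⟨w, hw, -, hb⟩
    rw [hx] at hw
    exact ⟨w, fun i => hw i i.isLt, hb⟩

theorem Mn_of_clone {X : Set (PF A)} (hX : IsPartialClone X) (n m : ℕ)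
    (σ : Fin (n+1) → Fin (m+1)) : Mn X n m σ := by
  intro f hf
  have := hX.2 _ hf m (fun i x => some (x (σ i))) (fun i => hX.1 m (σ i))
  have he : (fun x : Fin (m+1) → A => f (fun i => x (σ i))) =
      compFun f (fun i x => some (x (σ i))) := by
    funext x
    simp [compFun]
  rw [he]
  exact this

theorem star_of_clone {X : Set (PF A)} (hX : IsPartialClone X) :
    ∀ f ∈ X, ∀ g ∈ X, starPF f g ∈ X := by
  rintro ⟨n, f⟩ hf ⟨m, g⟩ hg
  have hg' := Mn_of_clone hX m (n+m) (fun j => ⟨j.val, by have := j.isLt; omega⟩) g hg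
  have := hX.2 _ hf (n+m) (fun i => if i.val = 0 then
      (fun x => g (fun j => x ⟨j.val, by have := j.isLt; omega⟩))
      else fun x => some (x ⟨m + i.val, by have := i.isLt; simp only at this; omega⟩)) (by
    intro i
    by_cases hi : i.val = 0
    · simp only [hi, if_true]; exact hg'
    · simp only [hi, if_false]; exact hX.1 _ _)
  refine Eq.mp (congrArg (fun h => (⟨n+m, h⟩ : PF A) ∈ X) ?_) this
  symm
  funext x
  apply Option.ext
  intro b
  rw [compFun_eq_some, Option.bind_eq_some_iff]
  constructor
  · rintro ⟨a, ha, hb⟩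
    refine ⟨_, fun i => ?_, hb⟩
    by_cases hi : i.val = 0
    · simp only [hi, if_true]; exact ha
    · simp only [hi, if_false]
  · rintro ⟨w, hw, hb⟩
    refine ⟨w 0, ?_, ?_⟩
    · have := hw 0
      simpa using this
    · convert hb using 2
      funext i
      have h := hw i
      by_cases hi : i.val = 0
      · have : i = 0 := Fin.ext hi
        subst this; simp
      · simp only [hi, if_false, Option.some.injEq] at h ⊢
        exact h

theorem PFle_mk {m : ℕ} {g : (Fin (m+1) → A) → Option A} {h : PF A} :
    PFle ⟨m, g⟩ h ↔ ∃ h' : (Fin (m+1) → A) → Option A, h = ⟨m, h'⟩ ∧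
      ∀ x a, g x = some a → h' x = some a := by
  constructor
  · obtain ⟨k, h⟩ := h
    rintro ⟨e, H⟩
    simp only at e
    subst e
    exact ⟨h, rfl, H⟩
  · rintro ⟨h', rfl, H⟩
    exact ⟨rfl, H⟩

theorem PFle_refl (f : PF A) : PFle f f := ⟨rfl, fun _ _ h => h⟩

theorem PFle_trans {f g h : PF A} (h1 : PFle f g) (h2 : PFle g h) : PFle f h := by
  obtain ⟨n, f⟩ := f
  obtain ⟨g', rfl, H⟩ := PFle_mk.1 h1
  obtain ⟨h', rfl, H'⟩ := PFle_mk.1 h2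
  exact PFle_mk.2 ⟨h', rfl, fun x a hh => H' x a (H x a hh)⟩

theorem PFle_total {f g : PF A} (h : PFle f g) (hf : IsTotalPF f) : f = g := by
  obtain ⟨n, f⟩ := f
  obtain ⟨g', rfl, H⟩ := PFle_mk.1 h
  congr 1
  funext x
  obtain ⟨a, ha⟩ := Option.isSome_iff_exists.1 (hf x)
  simp only at ha
  rw [ha, H x a ha]

theorem strSet_clone {D : Set (PF A)} (hD : IsPartialClone D) : IsPartialClone (StrSet D) := by
  refine ⟨fun n i => ⟨_, hD.1 n i, PFle_refl _⟩, ?_⟩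
  rintro ⟨n, f⟩ ⟨f0, hf0, hle⟩ m g hg
  obtain ⟨f', rfl, H⟩ := PFle_mk.1 hle
  have : ∀ i, ∃ g' : (Fin (m+1) → A) → Option A, (⟨m, g'⟩ : PF A) ∈ D ∧
      ∀ x a, g i x = some a → g' x = some a := by
    intro i
    obtain ⟨g0, hg0, hl⟩ := hg i
    obtain ⟨g', rfl, H⟩ := PFle_mk.1 hl
    exact ⟨g', hg0, H⟩
  choose g' hg' H' using this
  refine ⟨_, hD.2 _ hf0 m g' hg', PFle_mk.2 ⟨_, rfl, fun x a hx => ?_⟩⟩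
  rw [compFun_eq_some] at hx ⊢
  obtain ⟨w, hw, hb⟩ := hx
  exact ⟨w, fun i => H' i x _ (hw i), H _ _ hb⟩

theorem strong_downwards {A : Type} [Fintype A] (C D : Set (PF A))
    (hC : IsClone C) (hD : IsClone D) (hDC : D ⊆ C)
    (T : Set (PF A)) (hT : IsPartialClass T) (hTstrong : IsStrong T)
    (I : Set (Set (PF A))) (hI : I ⊆ Istr C)
    (h1 : T ∩ OSet A ⊆ D)
    (h2 : starSet T (StrSet D) ⊆ StrSet D ∪ T)
    (h2' : starSet (StrSet D) T ⊆ StrSet D ∪ T)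
    (h3 : ∀ X ∈ I, ∀ Y ∈ I, X ≠ Y → X ∩ T ≠ Y ∩ T) :
    Cardinal.mk ↥I ≤ Cardinal.mk ↥(Istr D) := by
  have strong_le : ∀ {Z : Set (PF A)}, IsStrong Z → ∀ {f g : PF A}, PFle f g → g ∈ Z → f ∈ Z := by
    intro Z hZ f g hfg hg
    rw [← hZ]; exact ⟨g, hg, hfg⟩
  have hDX : ∀ X ∈ I, StrSet D ⊆ X := by
    rintro X hX f ⟨g, hg, hfg⟩
    obtain ⟨-, hs, ho⟩ := hI hX
    have : g ∈ X := by
      have := hDC hg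
      rw [← ho] at this
      exact this.1
    exact strong_le hs hfg this
  have hSD := strSet_clone hD.1
  have hmem : ∀ X ∈ I, StrSet D ∪ (X ∩ T) ∈ Istr D := by
    intro X hX
    obtain ⟨hXc, hXs, hXo⟩ := hI hX
    refine ⟨clone_of_maltsev (fun n i => Or.inl (hSD.1 n i)) ?_ ?_, ?_, ?_⟩
    · rintro n m σ f (hf | hf)
      · exact Or.inl (Mn_of_clone hSD n m σ f hf)
      · exact Or.inr ⟨Mn_of_clone hXc n m σ f hf.1, Mn_all hT σ f hf.2⟩
    · have hsX := star_of_clone hXc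
      rintro f (hf | hf) g (hg | hg)
      · exact Or.inl (star_of_clone hSD f hf g hg)
      · rcases h2' ⟨f, hf, g, hg.2, rfl⟩ with h | h
        · exact Or.inl h
        · exact Or.inr ⟨hsX f (hDX X hX hf) g hg.1, h⟩
      · rcases h2 ⟨f, hf.2, g, hg, rfl⟩ with h | h
        · exact Or.inl h
        · exact Or.inr ⟨hsX f hf.1 g (hDX X hX hg), h⟩
      · exact Or.inr ⟨hsX f hf.1 g hg.1, hT.2.2.2.2 f hf.2 g hg.2⟩
    · apply Set.Subset.antisymm
      · rintro f ⟨g, hg | hg, hfg⟩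
        · obtain ⟨k, hk, hgk⟩ := hg
          exact Or.inl ⟨k, hk, PFle_trans hfg hgk⟩
        · exact Or.inr ⟨strong_le hXs hfg hg.1, strong_le hTstrong hfg hg.2⟩
      · intro f hf; exact ⟨f, hf, PFle_refl f⟩
    · apply Set.Subset.antisymm
      · rintro f ⟨hf | hf, hft⟩
        · obtain ⟨g, hg, hfg⟩ := hf
          rw [PFle_total hfg hft]; exact hg
        · exact h1 ⟨hf.2, hft⟩
      · intro f hf; exact ⟨Or.inl ⟨f, hf, PFle_refl f⟩, hD.2 hf⟩
  have hint : ∀ X ∈ I, (StrSet D ∪ (X ∩ T)) ∩ T = X ∩ T := by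
    intro X hX
    apply Set.Subset.antisymm
    · rintro f ⟨hf | hf, hft⟩
      · exact ⟨hDX X hX hf, hft⟩
      · exact hf
    · intro f hf; exact ⟨Or.inr hf, hf.2⟩
  refine Cardinal.mk_le_of_injective (f := fun X : I => (⟨_, hmem X.1 X.2⟩ : Istr D)) ?_
  rintro ⟨X, hX⟩ ⟨Y, hY⟩ hXY
  have hXY' : StrSet D ∪ (X ∩ T) = StrSet D ∪ (Y ∩ T) := congrArg Subtype.val hXY
  apply Subtype.ext
  by_contra hne
  apply h3 X hX Y hY hne
  rw [← hint X hX, ← hint Y hY, hXY']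

end StrongPartial
end

section
/- Let A be a finite set, a ∈ A, C a total clone on A containing the constant functions c_a with value a, and X ∈ I_str(C). For an n-ary partial function f, define the (n+1)-ary partial function f_a by dom f_a := {(a,x) : x ∈ dom f} and f_a(a,x) := f(x) for all x ∈ dom f. Then f ∈ X if and only if f_a ∈ X. -/
namespace StrongPartial

variable {A : Type}

theorem mem_iff_extConst_mem {A : Type} [Fintype A] [DecidableEq A] (a : A)
    (C : Set (PF A)) (hC : IsClone C) (hconst : ∀ n : ℕ, constPF a n ∈ C)
    (X : Set (PF A)) (hX : X ∈ Istr C) (f : PF A) :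
    f ∈ X ↔ extConst a f ∈ X := by
  obtain ⟨⟨hp, hc⟩, hs, ht⟩ := hX
  constructor
  · intro hf
    have h1 := hc f hf (f.1 + 1) (fun i x => some (x i.succ)) (fun i => hp (f.1 + 1) i.succ)
    rw [← hs]
    refine ⟨_, h1, rfl, ?_⟩
    intro x b hb
    change (if x 0 = a then f.2 (fun i => x i.succ) else none) = some b at hb
    split_ifs at hb with h0
    refine (dif_pos (fun _ => rfl)).trans ?_
    exact hb
  · intro hf
    have hca : constPF a f.1 ∈ X := by
      have := hconst f.1
      rw [← ht] at this
      exact this.1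
    have h1 := hc (extConst a f) hf f.1
      (fun i => Fin.cases (motive := fun _ => (Fin (f.1+1) → A) → Option A)
        (fun _ => some a) (fun j x => some (x j)) i)
      (fun i => by
        refine Fin.cases ?_ (fun j => ?_) i
        · exact hca
        · exact hp f.1 j)
    rw [← hs]
    refine ⟨_, h1, rfl, ?_⟩
    intro x b hb
    have hx : ∀ i : Fin (f.1+1+1), ((Fin.cases (motive := fun _ => (Fin (f.1+1) → A) → Option A)
        (fun _ => some a) (fun j x => some (x j)) i : (Fin (f.1+1) → A) → Option A) x).isSome := by
      intro i
      refine Fin.cases ?_ (fun j => ?_) i <;> rfl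
    change compFun _ _ x = some b
    unfold compFun
    refine (dif_pos hx).trans ?_
    change (if a = a then f.2 (fun i => x i) else none) = some b
    rw [if_pos rfl]
    exact hb

end StrongPartial
end
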